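/- arXiv:2407.18686 — 3 statements merged into one kernel-verified Lean document; each statement's English description precedes it below -/
import Mathlib

section
/- Fix m ≥ 2 and κ > 0. Let Ω = {(α,β,λ) ∈ (ℝ³)^m × (ℝ³)^m × (0,∞)^m : α_j ≠ α_k for j ≠ k} and, for P = (α,β,λ) ∈ Ω, set a(P) = min_{j≠k} |α_j − α_k| and α_{jk} = α_j − α_k. Let B_j : Ω → ℝ³ and M_j : Ω → ℝ (1 ≤ j ≤ m) be C¹ functions such that, writing r_j(P) = B_j(P) + ∑_{k≠j} (κ/(4π λ_k)) α_{jk}/|α_{jk}|³, for every compact set K ⊂ (ℝ³)^m × (0,∞)^m there is C_K > 0 with |r_j(P)| + a(P)|∂_α r_j(P)| + |∂_{(β,λ)} r_j(P)| ≤ C_K a(P)^{−3} and |M_j(P)| + a(P)|∂_α M_j(P)| + |∂_{(β,λ)} M_j(P)| ≤ C_K a(P)^{−2} whenever a(P) ≥ 1 and (β,λ) ∈ K. Let P^∞ = (α^∞, β^∞, λ^∞) be a solution of the m-body problem with constant κ and masses λ_j^∞ > 0, which is hyperbolic: there exist pairwise distinct a_1,…,a_m ∈ ℝ³ with α_j^∞(t)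 = a_j t + o(t) as t → +∞. Then there exist T₀ > 0 and P = (α, β, λ) ∈ C¹([T₀,∞); Ω) satisfying α̇_j(t) = 2β_j(t), β̇_j(t) = B_j(P(t)), λ̇_j(t) = M_j(P(t)) for all t ≥ T₀, together with the estimate max_j ( |α_j(t) − α_j^∞(t)| + |β_j(t) − β_j^∞(t)| + |λ_j(t) − λ_j^∞| ) ≤ t^{−1/2} for all t ≥ T₀. -/
open MeasureTheory Filter Real
open scoped Topology BigOperators

noncomputable section

abbrev E3 := EuclideanSpace ℝ (Fin 3)

/-- The modulation-parameter space: positions, velocities, scalings. -/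
abbrev Param (m : ℕ) := (Fin m → E3) × (Fin m → E3) × (Fin m → ℝ)

/-- Minimal mutual separation of a configuration. -/
def minsep {m : ℕ} (α : Fin m → E3) : ℝ :=
  sInf ((fun p : Fin m × Fin m => ‖α p.1 - α p.2‖) '' {p | p.1 ≠ p.2})

/-- Non-collision parameters with positive scalings. -/
def Omega (m : ℕ) : Set (Param m) :=
  {P | (∀ j k, j ≠ k → P.1 j ≠ P.1 k) ∧ ∀ j, 0 < P.2.2 j}

/-- solution of the `m`-body problem on `[T,∞)`. -/
def IsMBody (m : ℕ) (κ : ℝ) (lam : Fin m → ℝ) (T : ℝ) (α β : Fin m → ℝ → E3) : Prop :=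
  (∀ t, T ≤ t → ∀ j k, j ≠ k → α j t ≠ α k t) ∧
  (∀ j, ∀ t, T ≤ t → HasDerivAt (α j) ((2:ℝ) • β j t) t) ∧
  (∀ j, ∀ t, T ≤ t → HasDerivAt (β j)
    (-∑ k ∈ Finset.univ.erase j,
      (κ / (4 * π * lam k * ‖α j t - α k t‖ ^ 3)) • (α j t - α k t)) t)

section Tail

variable {E V : Type*} [NormedAddCommGroup E] [NormedAddCommGroup V]

/-- The tail integral `-∫_t^∞ f`, multiplied by `t ^ e` and frozen to the left of `T`. -/
def weightedTail [NormedSpace ℝ V] (T e : ℝ) (f : ℝ → V) (t : ℝ) : V :=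
  -((max t T) ^ e • ∫ s in Set.Ioi (max t T), f s)

lemma integrableOn_Ioi_of_norm_le_rpow {f : ℝ → V} (hf : Continuous f) {T e A : ℝ} (hT : 1 ≤ T)
    (he : 1 / 2 ≤ e) (hb : ∀ s, T ≤ s → ‖f s‖ ≤ A * s ^ (-(9 / 8 + e))) (t : ℝ) :
    IntegrableOn f (Set.Ioi t) := by
  have key : IntegrableOn f (Set.Ioi T) := by
    refine Integrable.mono' (g := fun s => A * s ^ (-(9 / 8 + e)))
      ((integrableOn_Ioi_rpow_of_lt (by linarith) (by linarith)).const_mul A)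
      hf.aestronglyMeasurable ?_
    exact (ae_restrict_mem measurableSet_Ioi).mono fun s hs => hb s (le_of_lt hs)
  have h2 : IntegrableOn f (Set.Ioc t T) :=
    (hf.integrableOn_Icc (a := t) (b := T)).mono_set Set.Ioc_subset_Icc_self
  refine (h2.union key).mono_set fun s hs => ?_
  rcases le_or_gt s T with h | h
  · exact Or.inl ⟨hs, h⟩
  · exact Or.inr h

lemma hasDerivAt_neg_integral_Ioi [NormedSpace ℝ V] [CompleteSpace V] {f : ℝ → V}
    (hf : Continuous f) (hi : ∀ t, IntegrableOn f (Set.Ioi t)) (t : ℝ) :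
    HasDerivAt (fun t => -∫ s in Set.Ioi t, f s) (f t) t := by
  have h : (fun t => -∫ s in Set.Ioi t, f s)
      = fun t => (∫ s in (0 : ℝ)..t, f s) - ∫ s in Set.Ioi (0 : ℝ), f s := by
    funext t
    rw [← intervalIntegral.integral_Ioi_sub_Ioi' (hi 0) (hi t)]
    abel
  rw [h]
  exact (hf.integral_hasStrictDerivAt 0 t).hasDerivAt.sub_const _

lemma norm_weightedTail_le [NormedSpace ℝ V] {f : ℝ → V} {T e A : ℝ} (hT : 1 ≤ T)
    (he : 1 / 2 ≤ e) (hA : 0 ≤ A) (hb : ∀ s, T ≤ s → ‖f s‖ ≤ A * s ^ (-(9 / 8 + e))) (t : ℝ) :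
    ‖weightedTail T e f t‖ ≤ 2 * A * T ^ (-(1 / 8) : ℝ) := by
  unfold weightedTail
  set τ := max t T with hτ
  have hτT : T ≤ τ := le_max_right _ _
  have hτ0 : 0 < τ := by linarith
  have h1 : ‖∫ s in Set.Ioi τ, f s‖ ≤ ∫ s in Set.Ioi τ, A * s ^ (-(9 / 8 + e)) := by
    refine norm_integral_le_of_norm_le
      ((integrableOn_Ioi_rpow_of_lt (by linarith) hτ0).const_mul A) ?_
    exact (ae_restrict_mem measurableSet_Ioi).mono fun s hs => hb s (hτT.trans (le_of_lt hs))
  rw [integral_const_mul, integral_Ioi_rpow_of_lt (by linarith) hτ0] at h1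
  have h2 : -τ ^ (-(9 / 8 + e) + 1) / (-(9 / 8 + e) + 1) ≤ 2 * τ ^ (-(9 / 8 + e) + 1) := by
    have hp : 0 < τ ^ (-(9 / 8 + e) + 1) := rpow_pos_of_pos hτ0 _
    rw [div_le_iff_of_neg (by linarith)]
    nlinarith
  rw [norm_neg, norm_smul, norm_of_nonneg (rpow_nonneg hτ0.le _)]
  calc τ ^ e * ‖∫ s in Set.Ioi τ, f s‖ ≤ τ ^ e * (A * (2 * τ ^ (-(9 / 8 + e) + 1))) := by
        gcongr
        exact h1.trans (by gcongr)
    _ = 2 * A * (τ ^ e * τ ^ (-(9 / 8 + e) + 1)) := by ring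
    _ = 2 * A * τ ^ (-(1 / 8) : ℝ) := by
        rw [← rpow_add hτ0]; congr 2; ring
    _ ≤ 2 * A * T ^ (-(1 / 8) : ℝ) := by
        gcongr ?_ * ?_
        exact rpow_le_rpow_of_nonpos (by linarith) hτT (by norm_num)

lemma continuous_weightedTail [NormedSpace ℝ V] [CompleteSpace V] {f : ℝ → V} (hf : Continuous f)
    {T e : ℝ} (hT : 1 ≤ T) (hi : ∀ t, IntegrableOn f (Set.Ioi t)) :
    Continuous (weightedTail T e f) := by
  have h1 : Continuous fun t => -∫ s in Set.Ioi t, f s :=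
    continuous_iff_continuousAt.2 fun t => (hasDerivAt_neg_integral_Ioi hf hi t).continuousAt
  have hm : Continuous fun t : ℝ => max t T := continuous_id.max continuous_const
  have h2 : Continuous fun t : ℝ => (max t T) ^ e :=
    hm.rpow_const fun t => Or.inl (by have := le_max_right t T; linarith)
  refine (h2.smul (h1.comp hm)).congr fun t => ?_
  simp [weightedTail]

lemma rpow_neg_smul_weightedTail [NormedSpace ℝ V] {T t : ℝ} (hT : 1 ≤ T) (ht : T ≤ t) (e : ℝ)
    (f : ℝ → V) : t ^ (-e) • weightedTail T e f t = -∫ s in Set.Ioi t, f s := by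
  rw [weightedTail, max_eq_left ht, smul_neg, smul_smul, ← rpow_add (by linarith)]
  simp

/-- A vector field which decays like `t ^ (-(9 / 8 + e))` on the ball of radius `D`, together with
its Lipschitz constant, and is continuous there. -/
structure DecayingField (T D A e : ℝ) (F : ℝ → E → V) : Prop where
  continuousOn : ContinuousOn (fun p : ℝ × E => F p.1 p.2)
    (Set.Ici T ×ˢ Metric.closedBall (0 : E) D)
  norm_zero_le : ∀ t, T ≤ t → ‖F t 0‖ ≤ A * t ^ (-(9 / 8 + e))
  norm_sub_le : ∀ t, T ≤ t → ∀ u v : E, ‖u‖ ≤ D → ‖v‖ ≤ D →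
    ‖F t u - F t v‖ ≤ A * t ^ (-(9 / 8 + e)) * ‖u - v‖

namespace DecayingField

variable {T D A e : ℝ} {F : ℝ → E → V}

lemma continuous_comp (hF : DecayingField T D A e F) {U : ℝ → E} (hU : Continuous U)
    (hUD : ∀ t, ‖U t‖ ≤ D) : Continuous fun s => F (max s T) (U s) := by
  refine hF.continuousOn.comp_continuous (f := fun s => (max s T, U s))
    ((continuous_id.max continuous_const).prodMk hU) fun s => ?_
  exact ⟨Set.mem_Ici.2 (le_max_right _ _), by simpa using hUD s⟩

lemma norm_comp_le (hF : DecayingField T D A e F) (hT : 1 ≤ T) (hA : 0 ≤ A) (hD : 0 ≤ D)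
    (hD1 : D ≤ 1) {U : ℝ → E} (hUD : ∀ t, ‖U t‖ ≤ D) (s : ℝ) (hs : T ≤ s) :
    ‖F (max s T) (U s)‖ ≤ 2 * A * s ^ (-(9 / 8 + e)) := by
  rw [max_eq_left hs]
  have h1 := hF.norm_zero_le s hs
  have h2 := hF.norm_sub_le s hs (U s) 0 (hUD s) (by simpa using hD)
  have h3 : 0 ≤ A * s ^ (-(9 / 8 + e)) := mul_nonneg hA (rpow_nonneg (by linarith) _)
  have h4 : ‖U s - 0‖ ≤ 1 := by simpa using (hUD s).trans hD1
  have h5 : ‖F s (U s)‖ ≤ ‖F s (U s) - F s 0‖ + ‖F s 0‖ := by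
    simpa using norm_add_le (F s (U s) - F s 0) (F s 0)
  nlinarith

lemma integrableOn_comp (hF : DecayingField T D A e F) (hT : 1 ≤ T) (he : 1 / 2 ≤ e) (hA : 0 ≤ A)
    (hD : 0 ≤ D) (hD1 : D ≤ 1) {U : ℝ → E} (hU : Continuous U) (hUD : ∀ t, ‖U t‖ ≤ D) (t : ℝ) :
    IntegrableOn (fun s => F (max s T) (U s)) (Set.Ioi t) :=
  integrableOn_Ioi_of_norm_le_rpow (hF.continuous_comp hU hUD) hT he
    (hF.norm_comp_le hT hA hD hD1 hUD) t

lemma norm_weightedTail_sub_le [NormedSpace ℝ V] (hF : DecayingField T D A e F) (hT : 1 ≤ T)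
    (he : 1 / 2 ≤ e) (hA : 0 ≤ A) (hD : 0 ≤ D) (hD1 : D ≤ 1) {U U' : ℝ → E} (hU : Continuous U)
    (hUD : ∀ t, ‖U t‖ ≤ D) (hU' : Continuous U') (hUD' : ∀ t, ‖U' t‖ ≤ D) {d : ℝ} (hd : 0 ≤ d)
    (hUU' : ∀ t, ‖U t - U' t‖ ≤ d) (t : ℝ) :
    ‖weightedTail T e (fun s => F (max s T) (U s)) t
      - weightedTail T e (fun s => F (max s T) (U' s)) t‖ ≤ 2 * (A * d) * T ^ (-(1 / 8) : ℝ) := by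
  have h : weightedTail T e (fun s => F (max s T) (U s)) t
      - weightedTail T e (fun s => F (max s T) (U' s)) t
      = weightedTail T e (fun s => F (max s T) (U s) - F (max s T) (U' s)) t := by
    unfold weightedTail
    rw [integral_sub (hF.integrableOn_comp hT he hA hD hD1 hU hUD _)
      (hF.integrableOn_comp hT he hA hD hD1 hU' hUD' _), smul_sub]
    abel
  rw [h]
  refine norm_weightedTail_le hT he (mul_nonneg hA hd) (fun s hs => ?_) t
  rw [max_eq_left hs]
  have h3 : 0 ≤ A * s ^ (-(9 / 8 + e)) := mul_nonneg hA (rpow_nonneg (by linarith) _)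
  calc _ ≤ A * s ^ (-(9 / 8 + e)) * ‖U s - U' s‖ :=
        hF.norm_sub_le s hs _ _ (hUD s) (hUD' s)
    _ ≤ A * s ^ (-(9 / 8 + e)) * d := by gcongr; exact hUU' s
    _ = _ := by ring

end DecayingField

end Tail

section FixedPoint

variable {X Y Z : Type*} [NormedAddCommGroup X] [NormedSpace ℝ X] [CompleteSpace X]
  [NormedAddCommGroup Y] [NormedSpace ℝ Y] [CompleteSpace Y]
  [NormedAddCommGroup Z] [NormedSpace ℝ Z] [CompleteSpace Z]

open BoundedContinuousFunction in
lemma exists_weightedTail_fixedPoint {T D A e₁ e₂ e₃ : ℝ} (hT : 1 ≤ T) (hD : 0 ≤ D) (hD1 : D ≤ 1)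
    (hA : 0 ≤ A) (he₁ : 1 / 2 ≤ e₁) (he₂ : 1 / 2 ≤ e₂) (he₃ : 1 / 2 ≤ e₃)
    {F₁ : ℝ → X × Y × Z → X} {F₂ : ℝ → X × Y × Z → Y} {F₃ : ℝ → X × Y × Z → Z}
    (h₁ : DecayingField T D A e₁ F₁) (h₂ : DecayingField T D A e₂ F₂)
    (h₃ : DecayingField T D A e₃ F₃)
    (hsmall : 4 * A * T ^ (-(1 / 8) : ℝ) ≤ D) :
    ∃ U : ℝ → X × Y × Z, Continuous U ∧ (∀ t, ‖U t‖ ≤ D) ∧ ∀ t, U t =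
      (weightedTail T e₁ (fun s => F₁ (max s T) (U s)) t,
        weightedTail T e₂ (fun s => F₂ (max s T) (U s)) t,
        weightedTail T e₃ (fun s => F₃ (max s T) (U s)) t) := by
  let S := Metric.closedBall (0 : ℝ →ᵇ X × Y × Z) D
  have hS : ∀ U : S, ∀ t, ‖U.1 t‖ ≤ D := fun U t =>
    (U.1.norm_coe_le_norm t).trans (mem_closedBall_zero_iff.1 U.2)
  have hex : ∀ U : S, ∃ V : S, ∀ t, V.1 t =
      (weightedTail T e₁ (fun s => F₁ (max s T) (U.1 s)) t,
        weightedTail T e₂ (fun s => F₂ (max s T) (U.1 s)) t,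
        weightedTail T e₃ (fun s => F₃ (max s T) (U.1 s)) t) := by
    intro U
    have hc := U.1.continuous
    have b₁ := norm_weightedTail_le hT he₁ (by positivity) (h₁.norm_comp_le hT hA hD hD1 (hS U))
    have b₂ := norm_weightedTail_le hT he₂ (by positivity) (h₂.norm_comp_le hT hA hD hD1 (hS U))
    have b₃ := norm_weightedTail_le hT he₃ (by positivity) (h₃.norm_comp_le hT hA hD hD1 (hS U))
    have c₁ := continuous_weightedTail (e := e₁) (h₁.continuous_comp hc (hS U)) hT
      (h₁.integrableOn_comp hT he₁ hA hD hD1 hc (hS U))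
    have c₂ := continuous_weightedTail (e := e₂) (h₂.continuous_comp hc (hS U)) hT
      (h₂.integrableOn_comp hT he₂ hA hD hD1 hc (hS U))
    have c₃ := continuous_weightedTail (e := e₃) (h₃.continuous_comp hc (hS U)) hT
      (h₃.integrableOn_comp hT he₃ hA hD hD1 hc (hS U))
    have hbd : ∀ t, ‖(weightedTail T e₁ (fun s => F₁ (max s T) (U.1 s)) t,
        weightedTail T e₂ (fun s => F₂ (max s T) (U.1 s)) t,
        weightedTail T e₃ (fun s => F₃ (max s T) (U.1 s)) t)‖ ≤ D := fun t =>
      norm_prod_le_iff.2 ⟨(b₁ t).trans (by linarith),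
        norm_prod_le_iff.2 ⟨(b₂ t).trans (by linarith), (b₃ t).trans (by linarith)⟩⟩
    refine ⟨⟨ofNormedAddCommGroup _ (c₁.prodMk (c₂.prodMk c₃)) D hbd, ?_⟩, fun t => rfl⟩
    rw [mem_closedBall_zero_iff]
    exact norm_ofNormedAddCommGroup_le _ hD hbd
  choose Φ hΦ using hex
  have hcontr : ContractingWith (1 / 2) Φ := by
    refine ⟨by rw [← NNReal.coe_lt_coe]; norm_num, LipschitzWith.of_dist_le_mul fun U V => ?_⟩
    have hd : 0 ≤ dist U V := dist_nonneg
    have hUV : ∀ t, ‖U.1 t - V.1 t‖ ≤ dist U V := fun t => by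
      rw [← dist_eq_norm]; exact dist_coe_le_dist (f := U.1) (g := V.1) t
    have hle : 2 * (A * dist U V) * T ^ (-(1 / 8) : ℝ) ≤ ((1 / 2 : NNReal) : ℝ) * dist U V := by
      push_cast
      nlinarith
    rw [Subtype.dist_eq, dist_le (by positivity)]
    intro t
    rw [hΦ, hΦ, dist_eq_norm]
    have cU := U.1.continuous
    have cV := V.1.continuous
    exact norm_prod_le_iff.2
      ⟨(h₁.norm_weightedTail_sub_le hT he₁ hA hD hD1 cU (hS U) cV (hS V) hd hUV t).trans hle,
      norm_prod_le_iff.2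
      ⟨(h₂.norm_weightedTail_sub_le hT he₂ hA hD hD1 cU (hS U) cV (hS V) hd hUV t).trans hle,
      (h₃.norm_weightedTail_sub_le hT he₃ hA hD hD1 cU (hS U) cV (hS V) hd hUV t).trans hle⟩⟩
  have : CompleteSpace S := Metric.isClosed_closedBall.completeSpace_coe
  have : Nonempty S := ⟨⟨0, by simpa [S] using hD⟩⟩
  set U := ContractingWith.fixedPoint Φ hcontr
  have hfix : Φ U = U := hcontr.fixedPoint_isFixedPt
  refine ⟨U.1, U.1.continuous, hS U, fun t => ?_⟩
  rw [← hΦ U t, hfix]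

end FixedPoint

section Scaling

variable {X Y Z : Type*} [NormedAddCommGroup X] [NormedSpace ℝ X]
  [NormedAddCommGroup Y] [NormedSpace ℝ Y] [NormedAddCommGroup Z] [NormedSpace ℝ Z]

/-- Rescaling of perturbations by the decay rates of the three components. -/
def decayScale (t : ℝ) (u : X × Y × Z) : X × Y × Z :=
  (t ^ (-(1 / 2) : ℝ) • u.1, t ^ (-(13 / 8) : ℝ) • u.2.1, t ^ (-(3 / 4) : ℝ) • u.2.2)

lemma norm_decayScale_le {t : ℝ} (ht : 1 ≤ t) (u : X × Y × Z) :
    ‖(decayScale t u).1‖ ≤ t ^ (-(1 / 2) : ℝ) * ‖u‖ ∧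
      ‖(decayScale t u).2.1‖ ≤ t ^ (-(13 / 8) : ℝ) * ‖u‖ ∧
      ‖(decayScale t u).2.2‖ ≤ t ^ (-(3 / 4) : ℝ) * ‖u‖ := by
  have ht0 : 0 ≤ t := by linarith
  have h1 : ‖u.1‖ ≤ ‖u‖ := norm_fst_le u
  have h2 : ‖u.2.1‖ ≤ ‖u‖ := (norm_fst_le u.2).trans (norm_snd_le u)
  have h3 : ‖u.2.2‖ ≤ ‖u‖ := (norm_snd_le u.2).trans (norm_snd_le u)
  simp only [decayScale, norm_smul, norm_of_nonneg (rpow_nonneg ht0 _)]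
  refine ⟨?_, ?_, ?_⟩ <;> gcongr

lemma decayScale_sub (t : ℝ) (u v : X × Y × Z) :
    decayScale t u - decayScale t v = decayScale t (u - v) := by
  simp [decayScale, smul_sub]

lemma norm_decayScale_le_rpow {t : ℝ} (ht : 1 ≤ t) (u : X × Y × Z) :
    ‖decayScale t u‖ ≤ t ^ (-(1 / 2) : ℝ) * ‖u‖ := by
  obtain ⟨h1, h2, h3⟩ := norm_decayScale_le ht u
  refine norm_prod_le_iff.2 ⟨h1, norm_prod_le_iff.2 ⟨h2.trans ?_, h3.trans ?_⟩⟩ <;>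
  · gcongr ?_ * _
    exact rpow_le_rpow_of_exponent_le ht (by norm_num)

lemma continuousOn_comp_decayScale {V : Type*} [NormedAddCommGroup V] {T D δ : ℝ} (hT : 1 ≤ T)
    (hδ : T ^ (-(1 / 2) : ℝ) * D ≤ δ) {g : ℝ → X × Y × Z → V}
    (hg : ContinuousOn (fun p : ℝ × (X × Y × Z) => g p.1 p.2)
      (Set.Ici T ×ˢ Metric.closedBall 0 δ)) :
    ContinuousOn (fun p : ℝ × (X × Y × Z) => g p.1 (decayScale p.1 p.2))
      (Set.Ici T ×ˢ Metric.closedBall 0 D) := by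
  refine hg.comp (f := fun p : ℝ × (X × Y × Z) => (p.1, decayScale p.1 p.2)) ?_ ?_
  · have hr : ∀ e : ℝ, ContinuousOn (fun p : ℝ × (X × Y × Z) => p.1 ^ e)
        (Set.Ici T ×ˢ Metric.closedBall 0 D) := fun e =>
      continuousOn_fst.rpow_const fun p hp => Or.inl (by
        have : T ≤ p.1 := hp.1
        linarith)
    exact continuousOn_fst.prodMk (((hr _).smul (by fun_prop)).prodMk
      (((hr _).smul (by fun_prop)).prodMk ((hr _).smul (by fun_prop))))
  · rintro ⟨t, u⟩ ⟨ht, hu⟩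
    have ht' : T ≤ t := ht
    have hu' : ‖u‖ ≤ D := by simpa using hu
    refine ⟨ht, mem_closedBall_zero_iff.2 ?_⟩
    calc ‖decayScale t u‖ ≤ t ^ (-(1 / 2) : ℝ) * ‖u‖ := norm_decayScale_le_rpow (hT.trans ht') u
      _ ≤ T ^ (-(1 / 2) : ℝ) * D := by
        gcongr ?_ * ?_
        exact rpow_le_rpow_of_nonpos (by linarith) ht' (by norm_num)
      _ ≤ δ := hδ

end Scaling

section DecayingSolution

variable {X Z : Type*} [NormedAddCommGroup X] [NormedSpace ℝ X] [CompleteSpace X]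
  [NormedAddCommGroup Z] [NormedSpace ℝ Z] [CompleteSpace Z]

/-- A perturbed second order system with decaying forcing, coupled to slowly varying parameters,
has a solution vanishing at infinity. -/
lemma exists_decaying_solution {T₁ C δ : ℝ} (hδ : 0 < δ) (hC : 0 ≤ C)
    {g : ℝ → X × X × Z → X} {h : ℝ → X × X × Z → Z}
    (hg : ContinuousOn (fun p : ℝ × (X × X × Z) => g p.1 p.2)
      (Set.Ici T₁ ×ˢ Metric.closedBall 0 δ))
    (hh : ContinuousOn (fun p : ℝ × (X × X × Z) => h p.1 p.2)
      (Set.Ici T₁ ×ˢ Metric.closedBall 0 δ))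
    (hg0 : ∀ t, T₁ ≤ t → ‖g t 0‖ ≤ C * t ^ (-3 : ℝ))
    (hgL : ∀ t, T₁ ≤ t → ∀ u v : X × X × Z, ‖u‖ ≤ δ → ‖v‖ ≤ δ → ‖g t u - g t v‖ ≤
      C * (t ^ (-3 : ℝ) * (‖(u - v).1‖ + ‖(u - v).2.1‖) + t ^ (-2 : ℝ) * ‖(u - v).2.2‖))
    (hh0 : ∀ t, T₁ ≤ t → ‖h t 0‖ ≤ C * t ^ (-2 : ℝ))
    (hhL : ∀ t, T₁ ≤ t → ∀ u v : X × X × Z, ‖u‖ ≤ δ → ‖v‖ ≤ δ → ‖h t u - h t v‖ ≤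
      C * t ^ (-2 : ℝ) * ‖u - v‖) :
    ∃ T₀, 1 ≤ T₀ ∧ T₁ ≤ T₀ ∧ ∃ (x y : ℝ → X) (z : ℝ → Z), ∀ t, T₀ ≤ t →
      ‖(x t, y t, z t)‖ ≤ δ ∧ ‖x t‖ + ‖y t‖ + ‖z t‖ ≤ t ^ (-(1 / 2) : ℝ) ∧
      HasDerivAt x ((2 : ℝ) • y t) t ∧ HasDerivAt y (g t (x t, y t, z t)) t ∧
      HasDerivAt z (h t (x t, y t, z t)) t := by
  set A := 3 * C + 2 with hA
  have hA0 : 0 ≤ A := by positivity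
  have hlim : ∀ᶠ T in atTop, 4 * A * T ^ (-(1 / 8) : ℝ) < 1 / 3 := by
    have := (tendsto_rpow_neg_atTop (y := 1 / 8) (by norm_num)).const_mul (4 * A)
    rw [mul_zero] at this
    exact this.eventually (gt_mem_nhds (by norm_num))
  have hlim' : ∀ᶠ T in atTop, T ^ (-(1 / 2) : ℝ) < δ :=
    (tendsto_rpow_neg_atTop (y := 1 / 2) (by norm_num)).eventually (gt_mem_nhds hδ)
  obtain ⟨T, hsmall, hTδ, hT1, hT⟩ := (hlim.and (hlim'.and
    ((eventually_ge_atTop T₁).and (eventually_ge_atTop 1)))).exists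
  have hsub : Set.Ici T ×ˢ Metric.closedBall (0 : X × X × Z) δ ⊆
      Set.Ici T₁ ×ˢ Metric.closedBall 0 δ :=
    Set.prod_mono (Set.Ici_subset_Ici.2 hT1) subset_rfl
  have hTp : 0 < T ^ (-(1 / 2) : ℝ) := rpow_pos_of_pos (by linarith) _
  have hDδ : T ^ (-(1 / 2) : ℝ) * (1 / 3) ≤ δ := by linarith
  have hscale : ∀ t, T ≤ t → ∀ u : X × X × Z, ‖u‖ ≤ 1 / 3 → ‖decayScale t u‖ ≤ δ := by
    intro t ht u hu
    calc ‖decayScale t u‖ ≤ t ^ (-(1 / 2) : ℝ) * ‖u‖ := norm_decayScale_le_rpow (hT.trans ht) u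
      _ ≤ T ^ (-(1 / 2) : ℝ) * (1 / 3) := by
        gcongr ?_ * ?_
        exact rpow_le_rpow_of_nonpos (by linarith) ht (by norm_num)
      _ ≤ δ := hDδ
  have hdz : ∀ t, decayScale t (0 : X × X × Z) = 0 := fun t => by simp [decayScale]
  have hmono : ∀ t, T ≤ t → ∀ a b : ℝ, a ≤ b → t ^ a ≤ t ^ b := fun t ht a b hab =>
    rpow_le_rpow_of_exponent_le (hT.trans ht) hab
  have hpos : ∀ t, T ≤ t → ∀ a : ℝ, 0 < t ^ a := fun t ht a => rpow_pos_of_pos (by linarith) a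
  have h₁ : DecayingField T (1 / 3) A (1 / 2)
      (fun (t : ℝ) (u : X × X × Z) => (2 : ℝ) • (decayScale t u).2.1) := by
    have key : ∀ t, T ≤ t → ∀ u : X × X × Z, ‖(2 : ℝ) • (decayScale t u).2.1‖ ≤
        A * t ^ (-(9 / 8 + 1 / 2) : ℝ) * ‖u‖ := by
      intro t ht u
      have h1 := (norm_decayScale_le (hT.trans ht) u).2.1
      have h2 : (-(9 / 8 + 1 / 2) : ℝ) = -(13 / 8) := by norm_num
      rw [norm_smul, h2, mul_assoc]
      have := hpos t ht (-(13 / 8))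
      calc ‖(2 : ℝ)‖ * ‖(decayScale t u).2.1‖ ≤ 2 * (t ^ (-(13 / 8) : ℝ) * ‖u‖) := by
            rw [norm_of_nonneg (by norm_num : (0:ℝ) ≤ 2)]; gcongr
        _ ≤ A * (t ^ (-(13 / 8) : ℝ) * ‖u‖) := by gcongr; linarith
    refine ⟨?_, fun t ht => ?_, fun t ht u v _ _ => ?_⟩
    · exact continuousOn_comp_decayScale (δ := δ) hT hDδ (g := fun _ u => (2 : ℝ) • u.2.1)
        (by fun_prop)
    · have := hpos t ht (-(9 / 8 + 1 / 2))
      simpa [hdz] using mul_nonneg hA0 this.le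
    · have := key t ht (u - v)
      rwa [← decayScale_sub, Prod.snd_sub, Prod.fst_sub, smul_sub] at this
  have h₂ : DecayingField T (1 / 3) A (13 / 8)
      (fun (t : ℝ) (u : X × X × Z) => g t (decayScale t u)) := by
    refine ⟨continuousOn_comp_decayScale hT hDδ (hg.mono hsub), fun t ht => ?_,
      fun t ht u v hu hv => ?_⟩
    · rw [hdz]
      refine (hg0 t (hT1.trans ht)).trans ?_
      have := (hpos t ht (-3)).le
      gcongr
      · linarith
      · exact hT.trans ht
      · norm_num
    · refine (hgL t (hT1.trans ht) _ _ (hscale t ht u hu) (hscale t ht v hv)).trans ?_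
      rw [decayScale_sub]
      obtain ⟨a1, a2, a3⟩ := norm_decayScale_le (hT.trans ht) (u - v)
      have e : (-(9 / 8 + 13 / 8) : ℝ) = -(11 / 4) := by norm_num
      rw [e]
      have b1 : t ^ (-3 : ℝ) * ‖(decayScale t (u - v)).1‖ ≤ t ^ (-(11 / 4) : ℝ) * ‖u - v‖ := by
        calc _ ≤ t ^ (-3 : ℝ) * (t ^ (-(1 / 2) : ℝ) * ‖u - v‖) := by
              gcongr; exact (hpos t ht _).le
          _ = t ^ (-3 + -(1 / 2) : ℝ) * ‖u - v‖ := by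
              rw [rpow_add (by linarith)]; ring
          _ ≤ _ := by gcongr ?_ * _; exact hmono t ht _ _ (by norm_num)
      have b2 : t ^ (-3 : ℝ) * ‖(decayScale t (u - v)).2.1‖ ≤ t ^ (-(11 / 4) : ℝ) * ‖u - v‖ := by
        calc _ ≤ t ^ (-3 : ℝ) * (t ^ (-(13 / 8) : ℝ) * ‖u - v‖) := by
              gcongr; exact (hpos t ht _).le
          _ = t ^ (-3 + -(13 / 8) : ℝ) * ‖u - v‖ := by
              rw [rpow_add (by linarith)]; ring
          _ ≤ _ := by gcongr ?_ * _; exact hmono t ht _ _ (by norm_num)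
      have b3 : t ^ (-2 : ℝ) * ‖(decayScale t (u - v)).2.2‖ ≤ t ^ (-(11 / 4) : ℝ) * ‖u - v‖ := by
        calc _ ≤ t ^ (-2 : ℝ) * (t ^ (-(3 / 4) : ℝ) * ‖u - v‖) := by
              gcongr; exact (hpos t ht _).le
          _ = t ^ (-2 + -(3 / 4) : ℝ) * ‖u - v‖ := by
              rw [rpow_add (by linarith)]; ring
          _ ≤ _ := by gcongr ?_ * _; exact hmono t ht _ _ (by norm_num)
      have b0 : 0 ≤ t ^ (-(11 / 4) : ℝ) * ‖u - v‖ := mul_nonneg (hpos t ht _).le (norm_nonneg _)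
      calc _ ≤ C * (3 * (t ^ (-(11 / 4) : ℝ) * ‖u - v‖)) := by gcongr; linarith
        _ ≤ _ := by rw [hA]; nlinarith
  have h₃ : DecayingField T (1 / 3) A (3 / 4)
      (fun (t : ℝ) (u : X × X × Z) => h t (decayScale t u)) := by
    have hm : ∀ t, T ≤ t → C * t ^ (-2 : ℝ) ≤ A * t ^ (-(9 / 8 + 3 / 4) : ℝ) := by
      intro t ht
      have := (hpos t ht (-2)).le
      gcongr
      · linarith
      · exact hT.trans ht
      · norm_num
    refine ⟨continuousOn_comp_decayScale hT hDδ (hh.mono hsub), fun t ht => ?_,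
      fun t ht u v hu hv => ?_⟩
    · rw [hdz]
      exact (hh0 t (hT1.trans ht)).trans (hm t ht)
    · refine (hhL t (hT1.trans ht) _ _ (hscale t ht u hu) (hscale t ht v hv)).trans ?_
      rw [decayScale_sub]
      have h1 : ‖decayScale t (u - v)‖ ≤ ‖u - v‖ := by
        refine (norm_decayScale_le_rpow (hT.trans ht) _).trans ?_
        exact mul_le_of_le_one_left (norm_nonneg _)
          (rpow_le_one_of_one_le_of_nonpos (hT.trans ht) (by norm_num))
      have := (hpos t ht (-2)).le
      have := (hpos t ht (-(9 / 8 + 3 / 4))).le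
      gcongr ?_ * ?_
      exact hm t ht
  obtain ⟨U, hUc, hUb, hU⟩ := exists_weightedTail_fixedPoint hT (by norm_num) (by norm_num) hA0
    le_rfl (by norm_num) (by norm_num) h₁ h₂ h₃ hsmall.le
  have hD0 : (0 : ℝ) ≤ 1 / 3 := by norm_num
  have hD1 : (1 / 3 : ℝ) ≤ 1 := by norm_num
  have d₁ := hasDerivAt_neg_integral_Ioi (h₁.continuous_comp hUc hUb)
    (h₁.integrableOn_comp hT le_rfl hA0 hD0 hD1 hUc hUb)
  have d₂ := hasDerivAt_neg_integral_Ioi (h₂.continuous_comp hUc hUb)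
    (h₂.integrableOn_comp hT (by norm_num) hA0 hD0 hD1 hUc hUb)
  have d₃ := hasDerivAt_neg_integral_Ioi (h₃.continuous_comp hUc hUb)
    (h₃.integrableOn_comp hT (by norm_num) hA0 hD0 hD1 hUc hUb)
  let x := fun t => -∫ s in Set.Ioi t, (2 : ℝ) • (decayScale (max s T) (U s)).2.1
  let y := fun t => -∫ s in Set.Ioi t, g (max s T) (decayScale (max s T) (U s))
  let z := fun t => -∫ s in Set.Ioi t, h (max s T) (decayScale (max s T) (U s))
  refine ⟨T, hT, hT1, x, y, z, fun t ht => ?_⟩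
  have hS : decayScale t (U t) = (x t, y t, z t) := by
    rw [hU t]
    simp only [decayScale, rpow_neg_smul_weightedTail hT ht]
    rfl
  have e₁ := d₁ t
  have e₂ := d₂ t
  have e₃ := d₃ t
  rw [max_eq_left ht, hS] at e₁ e₂ e₃
  refine ⟨hS ▸ hscale t ht _ (hUb t), ?_, e₁, e₂, e₃⟩
  obtain ⟨a1, a2, a3⟩ := norm_decayScale_le (hT.trans ht) (U t)
  rw [hS] at a1 a2 a3
  have m2 := hmono t ht (-(13 / 8)) (-(1 / 2)) (by norm_num)
  have m3 := hmono t ht (-(3 / 4)) (-(1 / 2)) (by norm_num)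
  have p1 := hpos t ht (-(1 / 2))
  have hb := hUb t
  have hn := norm_nonneg (U t)
  dsimp only at a1 a2 a3 ⊢
  nlinarith

end DecayingSolution

section Interaction

variable {V : Type*} [NormedAddCommGroup V] [NormedSpace ℝ V]

lemma norm_inv_cube_smul (v : V) : ‖(‖v‖ ^ 3)⁻¹ • v‖ = (‖v‖ ^ 2)⁻¹ := by
  rw [norm_smul, norm_inv, norm_pow, norm_norm]
  rcases eq_or_ne ‖v‖ 0 with h | h
  · simp [h]
  · field_simp

lemma norm_inv_cube_smul_sub_le {v w : V} {ρ : ℝ} (hρ : 0 < ρ) (hv : ρ ≤ ‖v‖) (hw : ρ ≤ ‖w‖) :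
    ‖(‖v‖ ^ 3)⁻¹ • v - (‖w‖ ^ 3)⁻¹ • w‖ ≤ 4 * (ρ ^ 3)⁻¹ * ‖v - w‖ := by
  have hv0 : 0 < ‖v‖ := hρ.trans_le hv
  have hw0 : 0 < ‖w‖ := hρ.trans_le hw
  have hsplit : (‖v‖ ^ 3)⁻¹ • v - (‖w‖ ^ 3)⁻¹ • w
      = (‖v‖ ^ 3)⁻¹ • (v - w) + ((‖v‖ ^ 3)⁻¹ - (‖w‖ ^ 3)⁻¹) • w := by
    rw [smul_sub, sub_smul]; abel
  have hd : |‖w‖ - ‖v‖| ≤ ‖v - w‖ := by rw [norm_sub_rev]; exact abs_norm_sub_norm_le w v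
  have hfac : ((‖v‖ ^ 3)⁻¹ - (‖w‖ ^ 3)⁻¹) * ‖w‖
      = (‖w‖ - ‖v‖) * ((‖v‖ ^ 3)⁻¹ + (‖v‖ ^ 2 * ‖w‖)⁻¹ + (‖v‖ * ‖w‖ ^ 2)⁻¹) := by
    field_simp
    ring
  have h1 : (‖v‖ ^ 3)⁻¹ ≤ (ρ ^ 3)⁻¹ := by gcongr
  have h2 : (‖v‖ ^ 2 * ‖w‖)⁻¹ ≤ (ρ ^ 3)⁻¹ := by
    rw [show ρ ^ 3 = ρ ^ 2 * ρ by ring]; gcongr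
  have h3 : (‖v‖ * ‖w‖ ^ 2)⁻¹ ≤ (ρ ^ 3)⁻¹ := by
    rw [show ρ ^ 3 = ρ * ρ ^ 2 by ring]; gcongr
  have h4 : ‖((‖v‖ ^ 3)⁻¹ - (‖w‖ ^ 3)⁻¹) • w‖ ≤ ‖v - w‖ * (3 * (ρ ^ 3)⁻¹) := by
    rw [norm_smul, ← norm_norm w, ← norm_mul, norm_norm, hfac, norm_mul, norm_eq_abs,
      norm_of_nonneg (by positivity)]
    gcongr
    linarith
  have h5 : ‖(‖v‖ ^ 3)⁻¹ • (v - w)‖ ≤ (ρ ^ 3)⁻¹ * ‖v - w‖ := by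
    rw [norm_smul, norm_of_nonneg (by positivity)]
    gcongr
  rw [hsplit]
  refine (norm_add_le _ _).trans ?_
  linarith

lemma norm_newton_sub_le {v w : V} {ρ l lam mu κ : ℝ} (hκ : 0 < κ) (hρ : 0 < ρ) (hl : 0 < l)
    (hv : ρ ≤ ‖v‖) (hw : ρ ≤ ‖w‖) (hlam : l ≤ lam) (hmu : l ≤ mu) :
    ‖(κ / (4 * π * lam * ‖v‖ ^ 3)) • v - (κ / (4 * π * mu * ‖w‖ ^ 3)) • w‖ ≤
      κ / (4 * π) * (4 * l⁻¹ * (ρ ^ 3)⁻¹ * ‖v - w‖ + (l ^ 2)⁻¹ * (ρ ^ 2)⁻¹ * |lam - mu|) := by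
  have hlam0 : 0 < lam := hl.trans_le hlam
  have hmu0 : 0 < mu := hl.trans_le hmu
  have hsplit : (κ / (4 * π * lam * ‖v‖ ^ 3)) • v - (κ / (4 * π * mu * ‖w‖ ^ 3)) • w
      = (κ / (4 * π)) • (lam⁻¹ • ((‖v‖ ^ 3)⁻¹ • v - (‖w‖ ^ 3)⁻¹ • w)
        + (lam⁻¹ - mu⁻¹) • ((‖w‖ ^ 3)⁻¹ • w)) := by
    have e : ∀ x y : ℝ, κ / (4 * π * x * y) = κ / (4 * π) * (x⁻¹ * y⁻¹) := fun x y => by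
      rw [div_eq_mul_inv, div_eq_mul_inv, mul_inv (4 * π * x), mul_inv (4 * π)]; ring
    rw [e, e]
    module
  have h1 : ‖lam⁻¹ • ((‖v‖ ^ 3)⁻¹ • v - (‖w‖ ^ 3)⁻¹ • w)‖ ≤
      l⁻¹ * (4 * (ρ ^ 3)⁻¹ * ‖v - w‖) := by
    rw [norm_smul, norm_of_nonneg (by positivity)]
    gcongr
    exact norm_inv_cube_smul_sub_le hρ hv hw
  have h2 : ‖(lam⁻¹ - mu⁻¹) • ((‖w‖ ^ 3)⁻¹ • w)‖ ≤ (l ^ 2)⁻¹ * |lam - mu| * (ρ ^ 2)⁻¹ := by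
    have e : lam⁻¹ - mu⁻¹ = (lam * mu)⁻¹ * (mu - lam) := by field_simp
    rw [norm_smul, norm_inv_cube_smul, e, norm_mul, norm_of_nonneg (by positivity),
      norm_eq_abs, abs_sub_comm mu lam]
    gcongr
    rw [sq]; gcongr
  rw [hsplit, norm_smul, norm_of_nonneg (by positivity)]
  gcongr
  refine (norm_add_le _ _).trans ?_
  linarith

lemma norm_newton_le {v : V} {ρ l lam κ : ℝ} (hκ : 0 < κ) (hρ : 0 < ρ) (hl : 0 < l)
    (hv : ρ ≤ ‖v‖) (hlam : l ≤ lam) :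
    ‖(κ / (4 * π * lam * ‖v‖ ^ 3)) • v‖ ≤ κ / (4 * π) * (l⁻¹ * (ρ ^ 2)⁻¹) := by
  have hlam0 : 0 < lam := hl.trans_le hlam
  have hv0 : 0 < ‖v‖ := hρ.trans_le hv
  have e : (κ / (4 * π * lam * ‖v‖ ^ 3)) • v
      = (κ / (4 * π) * lam⁻¹) • ((‖v‖ ^ 3)⁻¹ • v) := by
    rw [smul_smul]; congr 1; field_simp
  rw [e, norm_smul, norm_inv_cube_smul, norm_of_nonneg (by positivity), mul_assoc]
  gcongr

/-- The Newtonian attraction exerted on the `j`-th body by the other ones. -/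
def attraction {m : ℕ} (κ : ℝ) (j : Fin m) (α : Fin m → E3) (lam : Fin m → ℝ) : E3 :=
  ∑ k ∈ Finset.univ.erase j, (κ / (4 * π * lam k * ‖α j - α k‖ ^ 3)) • (α j - α k)

lemma norm_attraction_sub_le {m : ℕ} {κ ρ l : ℝ} (hκ : 0 < κ) (hρ : 0 < ρ) (hl : 0 < l)
    {α α' : Fin m → E3} {lam lam' : Fin m → ℝ} (hα : ∀ j k, j ≠ k → ρ ≤ ‖α j - α k‖)
    (hα' : ∀ j k, j ≠ k → ρ ≤ ‖α' j - α' k‖) (hlam : ∀ k, l ≤ lam k) (hlam' : ∀ k, l ≤ lam' k)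
    (j : Fin m) :
    ‖attraction κ j α lam - attraction κ j α' lam'‖ ≤ m * (κ / (4 * π)) *
      (8 * l⁻¹ * (ρ ^ 3)⁻¹ * ‖α - α'‖ + (l ^ 2)⁻¹ * (ρ ^ 2)⁻¹ * ‖lam - lam'‖) := by
  unfold attraction
  rw [← Finset.sum_sub_distrib]
  refine (norm_sum_le _ _).trans ?_
  have hterm : ∀ k ∈ Finset.univ.erase j,
      ‖(κ / (4 * π * lam k * ‖α j - α k‖ ^ 3)) • (α j - α k)
        - (κ / (4 * π * lam' k * ‖α' j - α' k‖ ^ 3)) • (α' j - α' k)‖ ≤ κ / (4 * π) *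
      (8 * l⁻¹ * (ρ ^ 3)⁻¹ * ‖α - α'‖ + (l ^ 2)⁻¹ * (ρ ^ 2)⁻¹ * ‖lam - lam'‖) := by
    intro k hk
    have hjk : j ≠ k := (Finset.ne_of_mem_erase hk).symm
    refine (norm_newton_sub_le hκ hρ hl (hα j k hjk) (hα' j k hjk) (hlam k) (hlam' k)).trans ?_
    have h1 : ‖(α j - α k) - (α' j - α' k)‖ ≤ 2 * ‖α - α'‖ := by
      have e : (α j - α k) - (α' j - α' k) = (α - α') j - (α - α') k := by
        simp only [Pi.sub_apply]; abel
      rw [e]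
      refine (norm_sub_le _ _).trans ?_
      have := norm_le_pi_norm (α - α') j
      have := norm_le_pi_norm (α - α') k
      linarith
    have h2 : |lam k - lam' k| ≤ ‖lam - lam'‖ := norm_le_pi_norm (lam - lam') k
    gcongr ?_ * (?_ + ?_ * ?_)
    calc 4 * l⁻¹ * (ρ ^ 3)⁻¹ * ‖(α j - α k) - (α' j - α' k)‖
        ≤ 4 * l⁻¹ * (ρ ^ 3)⁻¹ * (2 * ‖α - α'‖) := by gcongr
      _ = 8 * l⁻¹ * (ρ ^ 3)⁻¹ * ‖α - α'‖ := by ring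
  refine (Finset.sum_le_card_nsmul _ _ _ hterm).trans ?_
  rw [nsmul_eq_mul, mul_assoc (m : ℝ)]
  gcongr
  simp

lemma norm_attraction_le {m : ℕ} {κ ρ l : ℝ} (hκ : 0 < κ) (hρ : 0 < ρ) (hl : 0 < l)
    {α : Fin m → E3} {lam : Fin m → ℝ} (hα : ∀ j k, j ≠ k → ρ ≤ ‖α j - α k‖)
    (hlam : ∀ k, l ≤ lam k) (j : Fin m) :
    ‖attraction κ j α lam‖ ≤ m * (κ / (4 * π)) * (l⁻¹ * (ρ ^ 2)⁻¹) := by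
  refine (norm_sum_le _ _).trans ((Finset.sum_le_card_nsmul _ _ _ fun k hk =>
    norm_newton_le hκ hρ hl (hα j k (Finset.ne_of_mem_erase hk).symm) (hlam k)).trans ?_)
  rw [nsmul_eq_mul, mul_assoc (m : ℝ)]
  gcongr
  simp

lemma differentiableAt_attraction {m : ℕ} (κ : ℝ) (j : Fin m) {P : Param m} (hP : P ∈ Omega m) :
    DifferentiableAt ℝ (fun P : Param m => attraction κ j P.1 P.2.2) P := by
  unfold attraction
  refine DifferentiableAt.fun_sum fun k hk => ?_
  have hne : P.1 j - P.1 k ≠ 0 := sub_ne_zero.2 (hP.1 j k (Finset.ne_of_mem_erase hk).symm)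
  have hd : DifferentiableAt ℝ (fun P : Param m => P.1 j - P.1 k) P := by fun_prop
  have hlam : DifferentiableAt ℝ (fun P : Param m => P.2.2 k) P := by fun_prop
  have hden : 4 * π * P.2.2 k * ‖P.1 j - P.1 k‖ ^ 3 ≠ 0 := by
    have := hP.2 k
    positivity
  have hnorm : DifferentiableAt ℝ (fun P : Param m => ‖P.1 j - P.1 k‖) P := hd.norm ℝ hne
  have hprod : DifferentiableAt ℝ
      (fun P : Param m => 4 * π * P.2.2 k * ‖P.1 j - P.1 k‖ ^ 3) P := by fun_prop
  have hcoef : DifferentiableAt ℝ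
      (fun P : Param m => κ / (4 * π * P.2.2 k * ‖P.1 j - P.1 k‖ ^ 3)) P := by
    simp only [div_eq_mul_inv]
    exact (hprod.fun_inv hden).const_mul κ
  exact hcoef.smul hd

end Interaction

lemma isOpen_Omega (m : ℕ) : IsOpen (Omega m) := by
  have h : Omega m = (⋂ (j) (k) (_ : j ≠ k), {P : Param m | P.1 j ≠ P.1 k}) ∩
      ⋂ j, {P : Param m | 0 < P.2.2 j} := by
    ext P; simp [Omega]
  rw [h]
  refine IsOpen.inter ?_ ?_
  · refine isOpen_iInter_of_finite fun j => isOpen_iInter_of_finite fun k =>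
      isOpen_iInter_of_finite fun _ => ?_
    exact isOpen_ne_fun (by fun_prop) (by fun_prop)
  · exact isOpen_iInter_of_finite fun j => isOpen_lt (by fun_prop) (by fun_prop)

lemma le_minsep {m : ℕ} (hm : 2 ≤ m) {α : Fin m → E3} {ρ : ℝ}
    (h : ∀ j k, j ≠ k → ρ ≤ ‖α j - α k‖) : ρ ≤ minsep α := by
  refine le_csInf (Set.Nonempty.image _ ⟨(⟨0, by omega⟩, ⟨1, by omega⟩), by simp⟩) ?_
  rintro _ ⟨p, hp, rfl⟩
  exact h p.1 p.2 hp

lemma norm_sub_le_of_norm_fderiv_le_segment {E F : Type*} [NormedAddCommGroup E] [NormedSpace ℝ E]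
    [NormedAddCommGroup F] [NormedSpace ℝ F] {f : E → F} {u v : E} {K : ℝ}
    (hd : ∀ θ ∈ Set.Icc (0 : ℝ) 1, DifferentiableAt ℝ f (v + θ • (u - v)))
    (hb : ∀ θ ∈ Set.Icc (0 : ℝ) 1, ‖fderiv ℝ f (v + θ • (u - v)) (u - v)‖ ≤ K) :
    ‖f u - f v‖ ≤ K := by
  have h := norm_image_sub_le_of_norm_deriv_le_segment_01'
    (f := fun θ : ℝ => f (v + θ • (u - v)))
    (f' := fun θ => fderiv ℝ f (v + θ • (u - v)) (u - v)) (C := K)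
    (fun θ hθ => ?_) (fun θ hθ => hb θ (Set.Ico_subset_Icc_self hθ))
  · simpa using h
  · have h1 : HasDerivAt (fun θ : ℝ => v + θ • (u - v)) (u - v) θ := by
      simpa using ((hasDerivAt_id θ).smul_const (u - v)).const_add v
    exact ((hd θ hθ).hasFDerivAt.comp_hasDerivAt θ h1).hasDerivWithinAt

lemma norm_sub_le_of_partial_bounds {m : ℕ} {W : Type*} [NormedAddCommGroup W] [NormedSpace ℝ W]
    {f : Param m → W} {Q u v : Param m} {δ K₁ K₂ : ℝ} (hu : ‖u‖ ≤ δ) (hv : ‖v‖ ≤ δ)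
    (hd : ∀ w, ‖w‖ ≤ δ → DifferentiableAt ℝ f (Q + w))
    (h₁ : ∀ w, ‖w‖ ≤ δ → ∀ x : Fin m → E3, ‖fderiv ℝ f (Q + w) (x, 0, 0)‖ ≤ K₁ * ‖x‖)
    (h₂ : ∀ w, ‖w‖ ≤ δ → ∀ (y : Fin m → E3) (z : Fin m → ℝ),
      ‖fderiv ℝ f (Q + w) (0, y, z)‖ ≤ K₂ * max ‖y‖ ‖z‖) :
    ‖f (Q + u) - f (Q + v)‖ ≤ K₁ * ‖(u - v).1‖ + K₂ * ‖(u - v).2‖ := by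
  have hseg : ∀ θ ∈ Set.Icc (0 : ℝ) 1, ‖v + θ • (u - v)‖ ≤ δ := fun θ hθ =>
    mem_closedBall_zero_iff.1 ((convex_closedBall (0 : Param m) δ).add_smul_sub_mem
      (mem_closedBall_zero_iff.2 hv) (mem_closedBall_zero_iff.2 hu) hθ)
  have e : ∀ θ : ℝ, (Q + v) + θ • ((Q + u) - (Q + v)) = Q + (v + θ • (u - v)) := fun θ => by
    rw [add_sub_add_left_eq_sub, add_assoc]
  refine norm_sub_le_of_norm_fderiv_le_segment (fun θ hθ => ?_) fun θ hθ => ?_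
  · rw [e]; exact hd _ (hseg θ hθ)
  · rw [e, add_sub_add_left_eq_sub]
    have hsplit : u - v = ((u - v).1, 0, 0) + (0, (u - v).2.1, (u - v).2.2) :=
      Prod.ext (by simp) (Prod.ext (by simp) (by simp))
    calc ‖fderiv ℝ f (Q + (v + θ • (u - v))) (u - v)‖
        = ‖fderiv ℝ f (Q + (v + θ • (u - v))) ((u - v).1, 0, 0) +
            fderiv ℝ f (Q + (v + θ • (u - v))) (0, (u - v).2.1, (u - v).2.2)‖ := by
          rw [← map_add, ← hsplit]
      _ ≤ _ := (norm_add_le _ _).trans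
          (add_le_add (h₁ _ (hseg θ hθ) _) (h₂ _ (hseg θ hθ) _ _))

lemma exists_pos_forall_le {ι : Type*} [Finite ι] (f : ι → ℝ) (hf : ∀ i, 0 < f i) :
    ∃ d > 0, ∀ i, d ≤ f i := by
  have h : ∀ᶠ d in 𝓝[>] (0 : ℝ), ∀ i, d ≤ f i :=
    eventually_all.2 fun i => nhdsWithin_le_nhds ((gt_mem_nhds (hf i)).mono fun _ h => h.le)
  obtain ⟨d, hd, hd0⟩ := (h.and self_mem_nhdsWithin).exists
  exact ⟨d, hd0, hd⟩

lemma exists_linear_separation {m : ℕ} {α : Fin m → ℝ → E3} {a : Fin m → E3}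
    (ha : ∀ j k, j ≠ k → a j ≠ a k)
    (hasymp : ∀ j, Tendsto (fun t => ‖α j t - t • a j‖ / t) atTop (nhds 0)) :
    ∃ c > 0, ∀ᶠ t in atTop, ∀ j k, j ≠ k → c * t ≤ ‖α j t - α k t‖ := by
  obtain ⟨d, hd, hda⟩ := exists_pos_forall_le
    (fun p : {p : Fin m × Fin m // p.1 ≠ p.2} => ‖a p.1.1 - a p.1.2‖)
    (fun p => norm_pos_iff.2 (sub_ne_zero.2 (ha _ _ p.2)))
  refine ⟨d / 2, by positivity, ?_⟩
  have h1 : ∀ᶠ t in atTop, ∀ j, ‖α j t - t • a j‖ / t < d / 4 :=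
    eventually_all.2 fun j => (hasymp j).eventually (gt_mem_nhds (by positivity))
  filter_upwards [h1, eventually_gt_atTop 0] with t ht ht0 j k hjk
  have hj := (div_lt_iff₀ ht0).1 (ht j)
  have hk := (div_lt_iff₀ ht0).1 (ht k)
  have e : t • (a j - a k) = (α j t - α k t) - ((α j t - t • a j) - (α k t - t • a k)) := by
    rw [smul_sub]; abel
  have h2 : t * ‖a j - a k‖ ≤
      ‖α j t - α k t‖ + (‖α j t - t • a j‖ + ‖α k t - t • a k‖) := by
    calc t * ‖a j - a k‖ = ‖t • (a j - a k)‖ := by rw [norm_smul, norm_of_nonneg ht0.le]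
      _ ≤ _ := by
        rw [e]
        exact (norm_sub_le _ _).trans (by gcongr; exact norm_sub_le _ _)
  have h3 := hda ⟨(j, k), hjk⟩
  dsimp only at h3
  nlinarith

lemma norm_le_of_norm_deriv_le_inv_sq {V : Type*} [NormedAddCommGroup V] [NormedSpace ℝ V]
    {f f' : ℝ → V} {T C : ℝ} (hT : 0 < T) (hC : 0 ≤ C) (hf : ∀ t, T ≤ t → HasDerivAt f (f' t) t)
    (hb : ∀ t, T ≤ t → ‖f' t‖ ≤ C * (t ^ 2)⁻¹) (t : ℝ) (ht : T ≤ t) :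
    ‖f t‖ ≤ ‖f T‖ + C * T⁻¹ := by
  have h := image_norm_le_of_norm_deriv_right_le_deriv_boundary' (f := f) (a := T) (b := t)
    (f' := f') (B := fun s => ‖f T‖ + C * T⁻¹ - C * s⁻¹) (B' := fun s => C * (s ^ 2)⁻¹)
    (fun s hs => (hf s hs.1).continuousAt.continuousWithinAt)
    (fun s hs => (hf s hs.1).hasDerivWithinAt) (by simp) ?_ ?_ (fun s hs => hb s hs.1)
    (Set.right_mem_Icc.2 ht)
  · have : 0 ≤ C * t⁻¹ := mul_nonneg hC (inv_nonneg.2 (hT.le.trans ht))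
    linarith
  · have : ∀ s ∈ Set.Icc T t, s ≠ 0 := fun s hs => (hT.trans_le hs.1).ne'
    fun_prop (disch := assumption)
  · intro s hs
    have hs0 : s ≠ 0 := (hT.trans_le hs.1).ne'
    have := ((hasDerivAt_inv hs0).const_mul C).const_sub (‖f T‖ + C * T⁻¹)
    refine (this.congr_deriv ?_).hasDerivWithinAt
    ring

/-- existence of an exact trajectory of the modulation system shadowing a
hyperbolic solution of the `m`-body problem. -/
theorem approximate_trajectory_hyperbolic
    (m : ℕ) (hm : 2 ≤ m) (κ : ℝ) (hκ : 0 < κ)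
    (B : Fin m → Param m → E3) (M : Fin m → Param m → ℝ)
    (hB : ∀ j, ContDiffOn ℝ 1 (B j) (Omega m))
    (hM : ∀ j, ContDiffOn ℝ 1 (M j) (Omega m))
    (r : Fin m → Param m → E3)
    (hr : ∀ j P, r j P = B j P + ∑ k ∈ Finset.univ.erase j,
        (κ / (4 * π * P.2.2 k * ‖P.1 j - P.1 k‖ ^ 3)) • (P.1 j - P.1 k))
    (hbound : ∀ K : Set ((Fin m → E3) × (Fin m → ℝ)), IsCompact K →
      ∃ C > (0:ℝ), ∀ P ∈ Omega m, 1 ≤ minsep P.1 → (P.2.1, P.2.2) ∈ K → ∀ j,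
        (‖r j P‖ ≤ C * minsep P.1 ^ (-(3:ℤ)) ∧
          (∀ hα : Fin m → E3,
            ‖fderiv ℝ (r j) P (hα, 0, 0)‖ ≤ C * minsep P.1 ^ (-(4:ℤ)) * ‖hα‖) ∧
          (∀ (hβ : Fin m → E3) (hl : Fin m → ℝ),
            ‖fderiv ℝ (r j) P (0, hβ, hl)‖ ≤
              C * minsep P.1 ^ (-(3:ℤ)) * max ‖hβ‖ ‖hl‖)) ∧
        (|M j P| ≤ C * minsep P.1 ^ (-(2:ℤ)) ∧
          (∀ hα : Fin m → E3,
            ‖fderiv ℝ (M j) P (hα, 0, 0)‖ ≤ C * minsep P.1 ^ (-(3:ℤ)) * ‖hα‖) ∧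
          (∀ (hβ : Fin m → E3) (hl : Fin m → ℝ),
            ‖fderiv ℝ (M j) P (0, hβ, hl)‖ ≤
              C * minsep P.1 ^ (-(2:ℤ)) * max ‖hβ‖ ‖hl‖)))
    (lamInf : Fin m → ℝ) (hlamInf : ∀ j, 0 < lamInf j)
    (T : ℝ) (αInf βInf : Fin m → ℝ → E3)
    (hsol : IsMBody m κ lamInf T αInf βInf)
    (a : Fin m → E3) (ha : ∀ j k, j ≠ k → a j ≠ a k)
    (hasymp : ∀ j, Tendsto (fun t => ‖αInf j t - t • a j‖ / t) atTop (nhds 0)) :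
    ∃ T₀ : ℝ, 0 < T₀ ∧ T ≤ T₀ ∧
      ∃ (α β : Fin m → ℝ → E3) (lam : Fin m → ℝ → ℝ),
        (∀ t ∈ Set.Ici T₀,
          ((fun j => α j t, fun j => β j t, fun j => lam j t) : Param m) ∈ Omega m) ∧
        (∀ j, ∀ t ∈ Set.Ici T₀,
          HasDerivAt (α j) ((2:ℝ) • β j t) t ∧
          HasDerivAt (β j) (B j (fun i => α i t, fun i => β i t, fun i => lam i t)) t ∧
          HasDerivAt (lam j) (M j (fun i => α i t, fun i => β i t, fun i => lam i t)) t) ∧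
        (∀ t ∈ Set.Ici T₀, ∀ j,
          ‖α j t - αInf j t‖ + ‖β j t - βInf j t‖ + |lam j t - lamInf j| ≤
            t ^ (-(1:ℝ)/2)) := by
  obtain ⟨-, hαd, hβd⟩ := hsol
  obtain ⟨c₀, hc₀, hsep₀⟩ := exists_linear_separation ha hasymp
  obtain ⟨d, hd0, hdlam⟩ := exists_pos_forall_le lamInf hlamInf
  set c := c₀ / 2 with hc
  have hc0 : 0 < c := by positivity
  set δ := min (d / 2) 1 with hδ
  have hδ0 : 0 < δ := by positivity
  have hδ1 : δ ≤ 1 := min_le_right _ _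
  have hδlam : ∀ j, 2 * δ ≤ lamInf j := fun j => by
    have h1 : δ ≤ d / 2 := min_le_left _ _
    have h2 := hdlam j
    linarith
  obtain ⟨T₂, hT₂⟩ := eventually_atTop.1 hsep₀
  set T₁ := max (max T T₂) (max 1 (2 / c)) with hT₁
  have hT₁T : T ≤ T₁ := (le_max_left _ _).trans (le_max_left _ _)
  have hT₁1 : 1 ≤ T₁ := (le_max_left _ _).trans (le_max_right _ _)
  have hρ2 : ∀ t, T₁ ≤ t → 2 ≤ c * t := fun t ht => by
    have h1 : 2 / c ≤ t := ((le_max_right _ _).trans (le_max_right _ _)).trans ht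
    rw [div_le_iff₀ hc0] at h1
    linarith
  have hsep : ∀ t, T₁ ≤ t → ∀ j k, j ≠ k → 2 * (c * t) ≤ ‖αInf j t - αInf k t‖ :=
    fun t ht j k hjk => by
      have := hT₂ t (((le_max_right _ _).trans (le_max_left _ _)).trans ht) j k hjk
      rw [hc]; linarith
  obtain ⟨R, hR⟩ : ∃ R, ∀ t, T₁ ≤ t → ∀ j, ‖βInf j t‖ ≤ R := by
    set C := m * (κ / (4 * π)) * (δ⁻¹ * (c ^ 2)⁻¹) with hC
    have hC0 : 0 ≤ C := by positivity
    have hj : ∀ j, ∀ t, T₁ ≤ t → ‖βInf j t‖ ≤ ‖βInf j T₁‖ + C * T₁⁻¹ := fun j =>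
      norm_le_of_norm_deriv_le_inv_sq (by linarith) hC0
        (fun t ht => hβd j t (hT₁T.trans ht)) fun t ht => by
          have hct := hρ2 t ht
          rw [norm_neg]
          refine (norm_attraction_le (α := fun i => αInf i t) (ρ := c * t) hκ (by linarith) hδ0
            (fun j k hjk => by have := hsep t ht j k hjk; linarith)
            (fun k => by have := hδlam k; linarith) j).trans_eq ?_
          rw [hC, mul_pow, mul_inv]; ring
    refine ⟨∑ j, (‖βInf j T₁‖ + C * T₁⁻¹), fun t ht j => (hj j t ht).trans ?_⟩
    have hT₁i : 0 ≤ T₁⁻¹ := inv_nonneg.2 (by linarith)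
    exact Finset.single_le_sum (f := fun j => ‖βInf j T₁‖ + C * T₁⁻¹)
      (fun i _ => by positivity) (Finset.mem_univ j)
  set Q : ℝ → Param m := fun t => (fun j => αInf j t, fun j => βInf j t, lamInf) with hQ
  have hR0 : 0 ≤ R := (norm_nonneg _).trans (hR T₁ le_rfl ⟨0, by omega⟩)
  have hnear_sep : ∀ t, T₁ ≤ t → ∀ u : Param m, ‖u‖ ≤ δ → ∀ j k, j ≠ k →
      c * t ≤ ‖(Q t + u).1 j - (Q t + u).1 k‖ := by
    intro t ht u hu j k hjk
    have h1 := hsep t ht j k hjk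
    have h2 := hρ2 t ht
    have h3 : ‖u.1 j‖ ≤ 1 := ((norm_le_pi_norm u.1 j).trans (norm_fst_le u)).trans (hu.trans hδ1)
    have h4 : ‖u.1 k‖ ≤ 1 := ((norm_le_pi_norm u.1 k).trans (norm_fst_le u)).trans (hu.trans hδ1)
    have e : αInf j t - αInf k t = ((Q t + u).1 j - (Q t + u).1 k) - (u.1 j - u.1 k) := by
      simp only [hQ, Prod.fst_add, Pi.add_apply]; abel
    have h5 := norm_sub_le ((Q t + u).1 j - (Q t + u).1 k) (u.1 j - u.1 k)
    have h6 := norm_sub_le (u.1 j) (u.1 k)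
    rw [← e] at h5
    linarith
  have hnear_lam : ∀ t, ∀ u : Param m, ‖u‖ ≤ δ → ∀ j, δ ≤ (Q t + u).2.2 j := by
    intro t u hu j
    have h1 : |u.2.2 j| ≤ δ :=
      ((norm_le_pi_norm u.2.2 j).trans ((norm_snd_le u.2).trans (norm_snd_le u))).trans hu
    have h2 := hδlam j
    have h3 := (abs_le.1 h1).1
    simp only [hQ, Prod.snd_add, Pi.add_apply]
    linarith
  have hnear : ∀ t, T₁ ≤ t → ∀ u : Param m, ‖u‖ ≤ δ → Q t + u ∈ Omega m := by
    intro t ht u hu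
    refine ⟨fun j k hjk h => ?_, fun j => hδ0.trans_le (hnear_lam t u hu j)⟩
    have h1 := hnear_sep t ht u hu j k hjk
    have h2 := hρ2 t ht
    rw [h, sub_self, norm_zero] at h1
    linarith
  obtain ⟨C, hC0, hCb⟩ := hbound (Metric.closedBall 0 (R + ‖lamInf‖ + 1))
    (isCompact_closedBall _ _)
  have hK : ∀ t, T₁ ≤ t → ∀ u : Param m, ‖u‖ ≤ δ → ((Q t + u).2.1, (Q t + u).2.2) ∈
      Metric.closedBall (0 : (Fin m → E3) × (Fin m → ℝ)) (R + ‖lamInf‖ + 1) := by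
    intro t ht u hu
    have h1 : ‖fun j => βInf j t‖ ≤ R := (pi_norm_le_iff_of_nonneg hR0).2 (hR t ht)
    have h2 : ‖u.2.1‖ ≤ 1 := ((norm_fst_le u.2).trans (norm_snd_le u)).trans (hu.trans hδ1)
    have h3 : ‖u.2.2‖ ≤ 1 := ((norm_snd_le u.2).trans (norm_snd_le u)).trans (hu.trans hδ1)
    have h4 := norm_nonneg lamInf
    refine mem_closedBall_zero_iff.2 (norm_prod_le_iff.2 ⟨?_, ?_⟩)
    · exact (norm_add_le _ _).trans (by linarith)
    · exact (norm_add_le _ _).trans (by linarith)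
  have hms : ∀ t, T₁ ≤ t → ∀ u : Param m, ‖u‖ ≤ δ → c * t ≤ minsep (Q t + u).1 :=
    fun t ht u hu => le_minsep hm (hnear_sep t ht u hu)
  have hzp : ∀ t, T₁ ≤ t → ∀ u : Param m, ‖u‖ ≤ δ → ∀ n : ℕ,
      minsep (Q t + u).1 ^ (-(n : ℤ)) ≤ ((c * t) ^ n)⁻¹ := by
    intro t ht u hu n
    have h1 := hρ2 t ht
    have h2 := hms t ht u hu
    rw [zpow_neg, zpow_natCast]
    gcongr
  have hCb' := fun t ht u hu => hCb (Q t + u) (hnear t ht u hu)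
    (by have h1 := hρ2 t ht; have h2 := hms t ht u hu; linarith) (hK t ht u hu)
  have hBr : ∀ j P, B j P = r j P - attraction κ j P.1 P.2.2 := fun j P => by
    rw [hr, attraction]; abel
  have hrd : ∀ j, ∀ P ∈ Omega m, DifferentiableAt ℝ (r j) P := fun j P hP => by
    have h1 : r j = fun P => B j P + attraction κ j P.1 P.2.2 := funext fun P => hr j P
    rw [h1]
    exact (((hB j).differentiableOn one_ne_zero).differentiableAt
      ((isOpen_Omega m).mem_nhds hP)).add (differentiableAt_attraction κ j hP)
  have hMd : ∀ j, ∀ P ∈ Omega m, DifferentiableAt ℝ (M j) P := fun j P hP =>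
    ((hM j).differentiableOn one_ne_zero).differentiableAt ((isOpen_Omega m).mem_nhds hP)
  set q := (m : ℝ) * (κ / (4 * π)) with hq
  have hq0 : 0 ≤ q := by positivity
  set Γ := (c ^ 3)⁻¹ + (c ^ 2)⁻¹ with hΓ
  have hΓ0 : 0 ≤ Γ := by positivity
  have hpow3 : ∀ t, T₁ ≤ t → ((c * t) ^ 3)⁻¹ ≤ Γ * t ^ (-3 : ℝ) := fun t ht => by
    have ht0 : 0 < t := by linarith
    have : t ^ (-3 : ℝ) = (t ^ 3)⁻¹ := by rw [rpow_neg ht0.le]; norm_cast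
    rw [this, mul_pow, mul_inv]
    gcongr
    exact le_add_of_nonneg_right (by positivity)
  have hpow2 : ∀ t, T₁ ≤ t → ((c * t) ^ 2)⁻¹ ≤ Γ * t ^ (-2 : ℝ) := fun t ht => by
    have ht0 : 0 < t := by linarith
    have : t ^ (-2 : ℝ) = (t ^ 2)⁻¹ := by rw [rpow_neg ht0.le]; norm_cast
    rw [this, mul_pow, mul_inv]
    gcongr
    exact le_add_of_nonneg_left (by positivity)
  have hpow32 : ∀ t, T₁ ≤ t → ((c * t) ^ 3)⁻¹ ≤ ((c * t) ^ 2)⁻¹ := fun t ht => by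
    have := hρ2 t ht
    gcongr
    · linarith
    · norm_num
  have hpow43 : ∀ t, T₁ ≤ t → ((c * t) ^ 4)⁻¹ ≤ ((c * t) ^ 3)⁻¹ := fun t ht => by
    have := hρ2 t ht
    gcongr
    · linarith
    · norm_num
  have hpow0 : ∀ t, T₁ ≤ t → ∀ n : ℕ, 0 < ((c * t) ^ n)⁻¹ := fun t ht n => by
    have := hρ2 t ht
    positivity
  set g : ℝ → Param m → Fin m → E3 :=
    fun t u j => B j (Q t + u) + attraction κ j (Q t).1 (Q t).2.2 with hg
  set h : ℝ → Param m → Fin m → ℝ := fun t u j => M j (Q t + u) with hh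
  set L := (2 * C + q * (8 * δ⁻¹ + (δ ^ 2)⁻¹)) * Γ with hL
  have hL0 : 0 ≤ L := by positivity
  have hLC : C * Γ ≤ L := by
    rw [hL]
    have : 0 ≤ q * (8 * δ⁻¹ + (δ ^ 2)⁻¹) := by positivity
    gcongr
    linarith
  have hQc : ContinuousOn Q (Set.Ici T₁) := by
    refine ContinuousOn.prodMk (continuousOn_pi.2 fun j t ht => ?_)
      (ContinuousOn.prodMk (continuousOn_pi.2 fun j t ht => ?_) continuousOn_const)
    · exact (hαd j t (hT₁T.trans ht)).continuousAt.continuousWithinAt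
    · exact (hβd j t (hT₁T.trans ht)).continuousAt.continuousWithinAt
  have hQuc : ContinuousOn (fun p : ℝ × Param m => Q p.1 + p.2)
      (Set.Ici T₁ ×ˢ Metric.closedBall 0 δ) :=
    (hQc.comp continuousOn_fst fun p hp => hp.1).add continuousOn_snd
  have hQmaps : Set.MapsTo (fun p : ℝ × Param m => Q p.1 + p.2)
      (Set.Ici T₁ ×ˢ Metric.closedBall 0 δ) (Omega m) := fun p hp =>
    hnear p.1 hp.1 p.2 (mem_closedBall_zero_iff.1 hp.2)
  have hQ0 : ∀ t, T₁ ≤ t → Q t ∈ Omega m := fun t ht => by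
    simpa using hnear t ht 0 (by simpa using hδ0.le)
  have hgc : ContinuousOn (fun p : ℝ × Param m => g p.1 p.2)
      (Set.Ici T₁ ×ˢ Metric.closedBall 0 δ) := by
    refine continuousOn_pi.2 fun j => ((hB j).continuousOn.comp hQuc hQmaps).add ?_
    have h1 : ContinuousOn (fun P : Param m => attraction κ j P.1 P.2.2) (Omega m) :=
      fun P hP => (differentiableAt_attraction κ j hP).continuousAt.continuousWithinAt
    exact h1.comp (hQc.comp continuousOn_fst fun p hp => hp.1) fun p hp => hQ0 p.1 hp.1
  have hhc : ContinuousOn (fun p : ℝ × Param m => h p.1 p.2)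
      (Set.Ici T₁ ×ˢ Metric.closedBall 0 δ) :=
    continuousOn_pi.2 fun j => (hM j).continuousOn.comp hQuc hQmaps
  have hzero : ‖(0 : Param m)‖ ≤ δ := by simpa using hδ0.le
  have hg0 : ∀ t, T₁ ≤ t → ‖g t 0‖ ≤ L * t ^ (-3 : ℝ) := by
    intro t ht
    have ht0 : 0 < t := by linarith
    refine (pi_norm_le_iff_of_nonneg (by positivity)).2 fun j => ?_
    have e : g t 0 j = r j (Q t + 0) := by simp [hg, hBr]
    rw [e]
    calc ‖r j (Q t + 0)‖ ≤ C * minsep (Q t + 0).1 ^ (-(3 : ℤ)) := (hCb' t ht 0 hzero j).1.1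
      _ ≤ C * (Γ * t ^ (-3 : ℝ)) := by
        gcongr
        exact (hzp t ht 0 hzero 3).trans (hpow3 t ht)
      _ ≤ L * t ^ (-3 : ℝ) := by rw [← mul_assoc]; gcongr
  have hh0 : ∀ t, T₁ ≤ t → ‖h t 0‖ ≤ L * t ^ (-2 : ℝ) := by
    intro t ht
    have ht0 : 0 < t := by linarith
    refine (pi_norm_le_iff_of_nonneg (by positivity)).2 fun j => ?_
    calc ‖M j (Q t + 0)‖ ≤ C * minsep (Q t + 0).1 ^ (-(2 : ℤ)) := (hCb' t ht 0 hzero j).2.1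
      _ ≤ C * (Γ * t ^ (-2 : ℝ)) := by
        gcongr
        exact (hzp t ht 0 hzero 2).trans (hpow2 t ht)
      _ ≤ L * t ^ (-2 : ℝ) := by rw [← mul_assoc]; gcongr
  have hgL : ∀ t, T₁ ≤ t → ∀ u v : Param m, ‖u‖ ≤ δ → ‖v‖ ≤ δ → ‖g t u - g t v‖ ≤
      L * (t ^ (-3 : ℝ) * (‖(u - v).1‖ + ‖(u - v).2.1‖) + t ^ (-2 : ℝ) * ‖(u - v).2.2‖) := by
    intro t ht u v hu hv
    have ht0 : 0 < t := by linarith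
    refine (pi_norm_le_iff_of_nonneg (by positivity)).2 fun j => ?_
    have e : (g t u - g t v) j = (r j (Q t + u) - r j (Q t + v)) -
        (attraction κ j (Q t + u).1 (Q t + u).2.2
          - attraction κ j (Q t + v).1 (Q t + v).2.2) := by
      simp only [hg, hBr, Pi.sub_apply]; abel
    have h1 := norm_sub_le_of_partial_bounds (f := r j) (Q := Q t)
      (K₁ := C * ((c * t) ^ 3)⁻¹) (K₂ := C * ((c * t) ^ 3)⁻¹) hu hv
      (fun w hw => hrd j _ (hnear t ht w hw))
      (fun w hw x => ((hCb' t ht w hw j).1.2.1 x).trans (by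
        gcongr; exact (hzp t ht w hw 4).trans (hpow43 t ht)))
      (fun w hw y z => ((hCb' t ht w hw j).1.2.2 y z).trans (by
        gcongr; exact hzp t ht w hw 3))
    have h2 := norm_attraction_sub_le (ρ := c * t) hκ (by linarith [hρ2 t ht]) hδ0
      (hnear_sep t ht u hu) (hnear_sep t ht v hv) (hnear_lam t u hu) (hnear_lam t v hv) j
    have e1 : (Q t + u).1 - (Q t + v).1 = (u - v).1 := by simp
    have e2 : (Q t + u).2.2 - (Q t + v).2.2 = (u - v).2.2 := by simp
    rw [e1, e2] at h2
    have h3 : ‖(u - v).2‖ ≤ ‖(u - v).2.1‖ + ‖(u - v).2.2‖ :=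
      max_le_add_of_nonneg (norm_nonneg _) (norm_nonneg _)
    rw [e]
    refine (norm_sub_le _ _).trans ((add_le_add h1 h2).trans ?_)
    have p3 := hpow0 t ht 3
    have p2 := hpow0 t ht 2
    have p32 := hpow32 t ht
    have hX := norm_nonneg (u - v).1
    have hY := norm_nonneg (u - v).2.1
    have hZ := norm_nonneg (u - v).2.2
    generalize ‖(u - v).1‖ = X at *
    generalize ‖(u - v).2.1‖ = Y at *
    generalize ‖(u - v).2.2‖ = Z at *
    have i1 : C * ((c * t) ^ 3)⁻¹ * X + C * ((c * t) ^ 3)⁻¹ * ‖(u - v).2‖ ≤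
        C * (((c * t) ^ 3)⁻¹ * (X + Y) + ((c * t) ^ 2)⁻¹ * Z) := by
      calc _ ≤ C * ((c * t) ^ 3)⁻¹ * X + C * ((c * t) ^ 3)⁻¹ * (Y + Z) := by gcongr
        _ = C * (((c * t) ^ 3)⁻¹ * (X + Y) + ((c * t) ^ 3)⁻¹ * Z) := by ring
        _ ≤ _ := by gcongr
    have i2 : 8 * δ⁻¹ * ((c * t) ^ 3)⁻¹ * X + (δ ^ 2)⁻¹ * ((c * t) ^ 2)⁻¹ * Z ≤
        (8 * δ⁻¹ + (δ ^ 2)⁻¹) * (((c * t) ^ 3)⁻¹ * (X + Y) + ((c * t) ^ 2)⁻¹ * Z) := by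
      have : 0 ≤ 8 * δ⁻¹ * (((c * t) ^ 3)⁻¹ * Y + ((c * t) ^ 2)⁻¹ * Z) := by positivity
      have : 0 ≤ (δ ^ 2)⁻¹ * (((c * t) ^ 3)⁻¹ * (X + Y)) := by positivity
      linarith
    have i3 : 0 ≤ C * (((c * t) ^ 3)⁻¹ * (X + Y) + ((c * t) ^ 2)⁻¹ * Z) := by positivity
    calc _ ≤ C * (((c * t) ^ 3)⁻¹ * (X + Y) + ((c * t) ^ 2)⁻¹ * Z) +
          q * ((8 * δ⁻¹ + (δ ^ 2)⁻¹) *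
            (((c * t) ^ 3)⁻¹ * (X + Y) + ((c * t) ^ 2)⁻¹ * Z)) := by gcongr
      _ ≤ (2 * C + q * (8 * δ⁻¹ + (δ ^ 2)⁻¹)) *
          (((c * t) ^ 3)⁻¹ * (X + Y) + ((c * t) ^ 2)⁻¹ * Z) := by linarith
      _ ≤ (2 * C + q * (8 * δ⁻¹ + (δ ^ 2)⁻¹)) *
          (Γ * t ^ (-3 : ℝ) * (X + Y) + Γ * t ^ (-2 : ℝ) * Z) := by
        gcongr
        · exact hpow3 t ht
        · exact hpow2 t ht
      _ = L * (t ^ (-3 : ℝ) * (X + Y) + t ^ (-2 : ℝ) * Z) := by rw [hL]; ring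
  have hhL : ∀ t, T₁ ≤ t → ∀ u v : Param m, ‖u‖ ≤ δ → ‖v‖ ≤ δ → ‖h t u - h t v‖ ≤
      L * t ^ (-2 : ℝ) * ‖u - v‖ := by
    intro t ht u v hu hv
    have ht0 : 0 < t := by linarith
    refine (pi_norm_le_iff_of_nonneg (by positivity)).2 fun j => ?_
    have h1 := norm_sub_le_of_partial_bounds (f := M j) (Q := Q t)
      (K₁ := C * ((c * t) ^ 2)⁻¹) (K₂ := C * ((c * t) ^ 2)⁻¹) hu hv
      (fun w hw => hMd j _ (hnear t ht w hw))
      (fun w hw x => ((hCb' t ht w hw j).2.2.1 x).trans (by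
        gcongr; exact (hzp t ht w hw 3).trans (hpow32 t ht)))
      (fun w hw y z => ((hCb' t ht w hw j).2.2.2 y z).trans (by
        gcongr; exact hzp t ht w hw 2))
    have h2 : ‖(u - v).1‖ ≤ ‖u - v‖ := norm_fst_le _
    have h3 : ‖(u - v).2‖ ≤ ‖u - v‖ := norm_snd_le _
    have h4 : 2 * (C * Γ) ≤ L := by
      rw [hL]
      have : 0 ≤ q * (8 * δ⁻¹ + (δ ^ 2)⁻¹) * Γ := by positivity
      linarith
    have h5 := hpow0 t ht 2
    calc ‖M j (Q t + u) - M j (Q t + v)‖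
        ≤ C * ((c * t) ^ 2)⁻¹ * ‖(u - v).1‖ + C * ((c * t) ^ 2)⁻¹ * ‖(u - v).2‖ := h1
      _ ≤ C * ((c * t) ^ 2)⁻¹ * ‖u - v‖ + C * ((c * t) ^ 2)⁻¹ * ‖u - v‖ := by gcongr
      _ = 2 * C * ((c * t) ^ 2)⁻¹ * ‖u - v‖ := by ring
      _ ≤ 2 * C * (Γ * t ^ (-2 : ℝ)) * ‖u - v‖ := by gcongr; exact hpow2 t ht
      _ = 2 * (C * Γ) * t ^ (-2 : ℝ) * ‖u - v‖ := by ring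
      _ ≤ L * t ^ (-2 : ℝ) * ‖u - v‖ := by gcongr
  obtain ⟨T₀, hT₀1, hT₀, x, y, z, hsol⟩ :=
    exists_decaying_solution hδ0 hL0 hgc hhc hg0 hgL hh0 hhL
  have hP : ∀ t, ((fun j => αInf j t + x t j, fun j => βInf j t + y t j,
      fun j => lamInf j + z t j) : Param m) = Q t + (x t, y t, z t) := fun t => rfl
  refine ⟨T₀, by linarith, hT₁T.trans hT₀, fun j t => αInf j t + x t j,
    fun j t => βInf j t + y t j, fun j t => lamInf j + z t j, fun t ht => ?_, fun j t ht => ?_,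
    fun t ht j => ?_⟩
  · rw [hP]
    exact hnear t (hT₀.trans ht) _ (hsol t ht).1
  · obtain ⟨-, -, hx, hy, hz⟩ := hsol t ht
    have htT : T ≤ t := (hT₁T.trans hT₀).trans ht
    rw [hP]
    refine ⟨?_, ?_, ?_⟩
    · refine ((hαd j t htT).add (hasDerivAt_pi.1 hx j)).congr_deriv ?_
      simp [smul_add]
    · refine ((hβd j t htT).add (hasDerivAt_pi.1 hy j)).congr_deriv ?_
      simp only [hg, hQ, attraction]
      abel
    · exact (hasDerivAt_pi.1 hz j).const_add (lamInf j)
  · have h1 := (hsol t ht).2.1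
    have hx := norm_le_pi_norm (x t) j
    have hy := norm_le_pi_norm (y t) j
    have hz : |z t j| ≤ ‖z t‖ := norm_le_pi_norm (z t) j
    have e : (-(1 : ℝ) / 2) = -(1 / 2) := by norm_num
    rw [e]
    simp only [add_sub_cancel_left]
    linarith

end
end

section
/- Let n ∈ ℕ, A ∈ ℝ^{n×n}, and 0 < δ < κ. Let F : (0,∞) × ℝⁿ → ℝⁿ be continuous and continuously differentiable in its second variable, and assume sup_{|x| ≤ 1} ( |F(t,x)| + |∇_x F(t,x)| ) ≤ t^{−2−κ} for all t > 0. Then there exist T > 0 and x ∈ C²([T,∞); ℝⁿ) such that ẍ(t) = (1/t²) A x(t) + F(t, x(t)) for all t ≥ T, and |x(t)| ≤ t^{−δ} for all t ≥ T. -/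
open Filter Real
open scoped Topology

noncomputable section

section LinearFlow

variable {E : Type*} [NormedAddCommGroup E] [NormedSpace ℂ E]

/-- The flow `exp (s M)` of the linear equation `y' = M y`. -/
def linearFlow (M : E →L[ℂ] E) (s : ℝ) : E →L[ℂ] E := NormedSpace.exp (s • M)

lemma linearFlow_zero (M : E →L[ℂ] E) : linearFlow M 0 = 1 := by
  simp [linearFlow]

lemma linearFlow_neg_left (M : E →L[ℂ] E) (s : ℝ) : linearFlow (-M) s = linearFlow M (-s) := by
  simp [linearFlow]

lemma maxGenEigenspace_le_of_forall {M : E →L[ℂ] E} {z : ℂ} {V : Submodule ℂ E}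
    (h : ∀ v, M v - z • v ∈ V → v ∈ V) :
    Module.End.maxGenEigenspace (M : E →ₗ[ℂ] E) z ≤ V := by
  intro v hv
  obtain ⟨k, hk⟩ := (Module.End.mem_maxGenEigenspace _ _ _).1 hv
  induction k generalizing v with
  | zero => simp_all
  | succ k ih =>
    have hk' : (((M : E →ₗ[ℂ] E) - z • 1) ^ k) (M v - z • v) = 0 := by
      rw [pow_succ] at hk
      simpa using hk
    exact h v (ih ((Module.End.mem_maxGenEigenspace _ _ _).2 ⟨k, hk'⟩) hk')

lemma norm_linearFlow_apply_le {M Q : E →L[ℂ] E} {C N η S : ℝ}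
    (hQ : ∀ s, 0 ≤ s → ‖linearFlow M (-s) * Q‖ ≤ C)
    {f : ℝ → E} (hfN : ∀ r, S ≤ r → ‖f r‖ ≤ N * rexp (-η * r)) {r s : ℝ} (hr : S ≤ r)
    (hsr : s ≤ r) : ‖linearFlow M (s - r) (Q (f r))‖ ≤ C * N * rexp (-η * r) := by
  have h1 := hQ (r - s) (sub_nonneg.2 hsr)
  rw [neg_sub] at h1
  rw [mul_assoc]
  exact ((linearFlow M (s - r) * Q).le_opNorm (f r)).trans
    (mul_le_mul h1 (hfN r hr) (norm_nonneg _) ((norm_nonneg _).trans h1))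

variable [FiniteDimensional ℂ E]

lemma linearFlow_add (M : E →L[ℂ] E) (s t : ℝ) :
    linearFlow M (s + t) = linearFlow M s * linearFlow M t := by
  have : CompleteSpace E := FiniteDimensional.complete ℂ E
  let _ : NormedAlgebra ℚ (E →L[ℂ] E) := NormedAlgebra.restrictScalars ℚ ℝ _
  rw [linearFlow, add_smul, NormedSpace.exp_add_of_commute]
  · rfl
  · exact ((Commute.refl M).smul_left s).smul_right t

lemma hasDerivAt_linearFlow (M : E →L[ℂ] E) (s : ℝ) :
    HasDerivAt (linearFlow M) (M * linearFlow M s) s :=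
  have : CompleteSpace E := FiniteDimensional.complete ℂ E
  hasDerivAt_exp_smul_const' M s

lemma hasDerivAt_linearFlow_apply (M : E →L[ℂ] E) (s : ℝ) (v : E) :
    HasDerivAt (fun r => linearFlow M r v) (linearFlow M s (M v)) s := by
  have : CompleteSpace E := FiniteDimensional.complete ℂ E
  have h : HasDerivAt (linearFlow M) (linearFlow M s * M) s := hasDerivAt_exp_smul_const M s
  exact (((ContinuousLinearMap.apply ℂ E v).restrictScalars ℝ).hasFDerivAt.comp_hasDerivAt s h)

@[fun_prop]
lemma continuous_linearFlow (M : E →L[ℂ] E) : Continuous (linearFlow M) :=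
  continuous_iff_continuousAt.2 fun s => (hasDerivAt_linearFlow M s).continuousAt

/-- The vectors whose forward orbit under the flow of `M` is bounded. -/
def boundedOrbits (M : E →L[ℂ] E) : Submodule ℂ E where
  carrier := {v | ∃ C, ∀ s, 0 ≤ s → ‖linearFlow M s v‖ ≤ C}
  add_mem' := by
    rintro v w ⟨C, hC⟩ ⟨D, hD⟩
    refine ⟨C + D, fun s hs => ?_⟩
    rw [map_add]
    exact (norm_add_le _ _).trans (add_le_add (hC s hs) (hD s hs))
  zero_mem' := ⟨0, by simp⟩
  smul_mem' := by
    rintro c v ⟨C, hC⟩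
    refine ⟨‖c‖ * C, fun s hs => ?_⟩
    rw [map_smul, norm_smul]
    exact mul_le_mul_of_nonneg_left (hC s hs) (norm_nonneg c)

lemma mem_boundedOrbits_of_sub_smul_mem {M : E →L[ℂ] E} {z : ℂ} (hz : z.re < 0) {v : E}
    (hv : M v - z • v ∈ boundedOrbits M) : v ∈ boundedOrbits M := by
  obtain ⟨C, hC⟩ := hv
  have hC0 : 0 ≤ C := (norm_nonneg _).trans (hC 0 le_rfl)
  refine ⟨‖v‖ + C / (-z.re), fun s hs => ?_⟩
  have hexp (r : ℝ) :
      HasDerivAt (fun r : ℝ => Complex.exp (-z * r)) (Complex.exp (-z * r) * -z) r := by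
    have h1 : HasDerivAt (fun r : ℝ => -z * (r : ℂ)) (-z) r := by
      simpa using (Complex.ofRealCLM.hasDerivAt (x := r)).const_mul (-z)
    exact h1.cexp
  have hu (r : ℝ) : HasDerivAt (fun r : ℝ => Complex.exp (-z * r) • linearFlow M r v)
      (Complex.exp (-z * r) • linearFlow M r (M v - z • v)) r := by
    have := (hexp r).smul (hasDerivAt_linearFlow_apply M r v)
    refine this.congr_deriv ?_
    rw [map_sub, map_smul]
    module
  have hnorm (r : ℝ) : ‖Complex.exp (-z * r)‖ = rexp (-z.re * r) := by
    rw [Complex.norm_exp]; simp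
  have hB (r : ℝ) : HasDerivAt (fun r : ℝ => ‖v‖ + C / (-z.re) * (rexp (-z.re * r) - 1))
      (C * rexp (-z.re * r)) r := by
    have h1 : HasDerivAt (fun r : ℝ => -z.re * r) (-z.re) r := by
      simpa using (hasDerivAt_id r).const_mul (-z.re)
    refine (((h1.exp.sub_const 1).const_mul (C / (-z.re))).const_add ‖v‖).congr_deriv ?_
    field_simp [hz.ne]
  have key := image_norm_le_of_norm_deriv_right_le_deriv_boundary (a := 0) (b := s)
    (fun r _ => (hu r).continuousAt.continuousWithinAt) (fun r _ => (hu r).hasDerivWithinAt)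
    (by simp [linearFlow_zero]) hB
    (fun r hr => by
      rw [norm_smul, hnorm, mul_comm]
      exact mul_le_mul_of_nonneg_right (hC r hr.1) (exp_pos _).le) (Set.right_mem_Icc.2 hs)
  rw [norm_smul, hnorm] at key
  have h1 : 1 ≤ rexp (-z.re * s) := one_le_exp (mul_nonneg (by linarith) hs)
  have h2 : 0 ≤ C / (-z.re) := div_nonneg hC0 (by linarith)
  refine le_of_mul_le_mul_left (key.trans ?_) (exp_pos (-z.re * s))
  nlinarith [norm_nonneg v, mul_nonneg (norm_nonneg v) (sub_nonneg.2 h1)]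

lemma boundedOrbits_sup_eq_top {M : E →L[ℂ] E}
    (hM : ∀ (z : ℂ) (v : E), z.re = 0 → M v = z • v → v = 0) :
    boundedOrbits M ⊔ boundedOrbits (-M) = ⊤ := by
  rw [eq_top_iff, ← Module.End.iSup_maxGenEigenspace_eq_top (M : E →ₗ[ℂ] E)]
  refine iSup_le fun z => ?_
  rcases lt_trichotomy z.re 0 with hz | hz | hz
  · exact (maxGenEigenspace_le_of_forall fun v => mem_boundedOrbits_of_sub_smul_mem hz).trans
      le_sup_left
  · refine (maxGenEigenspace_le_of_forall (V := ⊥) fun v hv => ?_).trans bot_le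
    exact hM z v hz (sub_eq_zero.1 ((Submodule.mem_bot ℂ).1 hv))
  · refine (maxGenEigenspace_le_of_forall fun v hv => ?_).trans le_sup_right
    refine mem_boundedOrbits_of_sub_smul_mem (z := -z) (by simpa using hz) ?_
    have := neg_mem hv
    convert this using 1
    simp only [neg_apply]
    module

lemma exists_norm_linearFlow_mul_le {M P : E →L[ℂ] E} (hP : ∀ v, P v ∈ boundedOrbits M) :
    ∃ C, ∀ s, 0 ≤ s → ‖linearFlow M s * P‖ ≤ C := by
  have : CompleteSpace E := FiniteDimensional.complete ℂ E
  choose C hC using hP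
  obtain ⟨K, hK⟩ := banach_steinhaus (g := fun s : Set.Ici (0 : ℝ) => linearFlow M s * P)
    fun v => ⟨C v, fun s => hC v s s.2⟩
  exact ⟨K, fun s hs => hK ⟨s, hs⟩⟩

lemma exists_exponential_dichotomy {M : E →L[ℂ] E}
    (hM : ∀ (z : ℂ) (v : E), z.re = 0 → M v = z • v → v = 0) :
    ∃ (C : ℝ) (P Q : E →L[ℂ] E), P + Q = 1 ∧ ∀ s, 0 ≤ s →
      ‖linearFlow M s * P‖ ≤ C ∧ ‖linearFlow M (-s) * Q‖ ≤ C := by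
  obtain ⟨V, hVle, hV⟩ := (codisjoint_iff.2 (boundedOrbits_sup_eq_top hM)).exists_isCompl
  have hPmem (v : E) : V.projection (boundedOrbits (-M)) hV v ∈ boundedOrbits M :=
    hVle (Submodule.projection_apply_mem hV v)
  have hQmem (v : E) : (boundedOrbits (-M)).projection V hV.symm v ∈ boundedOrbits (-M) :=
    Submodule.projection_apply_mem hV.symm v
  obtain ⟨C, hC⟩ := exists_norm_linearFlow_mul_le
    (P := (V.projection (boundedOrbits (-M)) hV).toContinuousLinearMap) hPmem
  obtain ⟨D, hD⟩ := exists_norm_linearFlow_mul_le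
    (P := ((boundedOrbits (-M)).projection V hV.symm).toContinuousLinearMap) hQmem
  refine ⟨max C D, (V.projection (boundedOrbits (-M)) hV).toContinuousLinearMap,
    ((boundedOrbits (-M)).projection V hV.symm).toContinuousLinearMap, ?_,
    fun s hs => ⟨(hC s hs).trans (le_max_left _ _), ?_⟩⟩
  · ext v
    exact Submodule.projection_add_projection_eq_self hV v
  · rw [← linearFlow_neg_left]
    exact (hD s hs).trans (le_max_right _ _)

/-- The solution of `y' = M y + f` on `[S, ∞)` that has no growing component, where `Q` projects
onto the directions that are bounded in backward time. -/
def dichotomySolution (M Q : E →L[ℂ] E) (S : ℝ) (f : ℝ → E) (s : ℝ) : E :=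
  linearFlow M s ((∫ r in S..s, linearFlow M (-r) (f r)) -
    ∫ r in Set.Ioi S, linearFlow M (-r) (Q (f r)))

lemma hasDerivAt_dichotomySolution (M Q : E →L[ℂ] E) (S : ℝ) {f : ℝ → E} (hf : Continuous f)
    (s : ℝ) :
    HasDerivAt (dichotomySolution M Q S f) (M (dichotomySolution M Q S f s) + f s) s := by
  have : CompleteSpace E := FiniteDimensional.complete ℂ E
  have hc : Continuous fun r => linearFlow M (-r) (f r) := by fun_prop
  have h1 := ((hc.integral_hasStrictDerivAt S s).hasDerivAt).sub_const
    (∫ r in Set.Ioi S, linearFlow M (-r) (Q (f r)))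
  have h2 : HasDerivAt (fun r => (linearFlow M r).restrictScalars ℝ)
      ((M * linearFlow M s).restrictScalars ℝ) s :=
    (ContinuousLinearMap.restrictScalarsL ℂ E E ℝ ℝ).hasFDerivAt.comp_hasDerivAt s
      (hasDerivAt_linearFlow M s)
  refine (h2.clm_apply h1).congr_deriv ?_
  have h3 : linearFlow M s (linearFlow M (-s) (f s)) = f s := by
    rw [← mul_apply_eq_comp, ← linearFlow_add, add_neg_cancel, linearFlow_zero]
    rfl
  simp [dichotomySolution, h3]

variable {M P Q : E →L[ℂ] E} {C N η S : ℝ}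

lemma integrableOn_linearFlow_apply (hη : 0 < η) (hQ : ∀ s, 0 ≤ s → ‖linearFlow M (-s) * Q‖ ≤ C)
    {f : ℝ → E} (hf : Continuous f) (hfN : ∀ r, S ≤ r → ‖f r‖ ≤ N * rexp (-η * r)) {s u : ℝ}
    (hS : S ≤ u) (hsu : s ≤ u) :
    MeasureTheory.IntegrableOn (fun r => linearFlow M (s - r) (Q (f r))) (Set.Ioi u) := by
  have hc : Continuous fun r => linearFlow M (s - r) (Q (f r)) := by fun_prop
  refine MeasureTheory.Integrable.mono'
    ((exp_neg_integrableOn_Ioi u hη).const_mul (C * N)) hc.aestronglyMeasurable ?_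
  filter_upwards [MeasureTheory.ae_restrict_mem measurableSet_Ioi] with r hr
  exact norm_linearFlow_apply_le hQ hfN (hS.trans (le_of_lt hr)) (hsu.trans (le_of_lt hr))

lemma norm_dichotomySolution_le (hη : 0 < η) (hS : 0 ≤ S) (hPQ : P + Q = 1)
    (hP : ∀ s, 0 ≤ s → ‖linearFlow M s * P‖ ≤ C) (hQ : ∀ s, 0 ≤ s → ‖linearFlow M (-s) * Q‖ ≤ C)
    {f : ℝ → E} (hf : Continuous f) (hfN : ∀ r, S ≤ r → ‖f r‖ ≤ N * rexp (-η * r)) {s : ℝ}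
    (hs : S ≤ s) :
    ‖dichotomySolution M Q S f s‖ ≤ C * N * (rexp (-η * S) / η) := by
  have : CompleteSpace E := FiniteDimensional.complete ℂ E
  have hcP : Continuous fun r => linearFlow M (-r) (P (f r)) := by fun_prop
  have hcQ : Continuous fun r => linearFlow M (-r) (Q (f r)) := by fun_prop
  have hint (u : ℝ) (hu : S ≤ u) :
      MeasureTheory.IntegrableOn (fun r => linearFlow M (-r) (Q (f r))) (Set.Ioi u) := by
    simpa using integrableOn_linearFlow_apply hη hQ hf hfN hu (hS.trans hu)
  have hflow (v : E) (r : ℝ) : linearFlow M s (linearFlow M (-r) v) = linearFlow M (s - r) v := by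
    rw [sub_eq_add_neg, linearFlow_add]; rfl
  have hsplit : dichotomySolution M Q S f s =
      (∫ r in S..s, linearFlow M (s - r) (P (f r))) -
        ∫ r in Set.Ioi s, linearFlow M (s - r) (Q (f r)) := by
    have h1 : (∫ r in S..s, linearFlow M (-r) (f r)) =
        (∫ r in S..s, linearFlow M (-r) (P (f r))) + ∫ r in S..s, linearFlow M (-r) (Q (f r)) := by
      rw [← intervalIntegral.integral_add (hcP.intervalIntegrable _ _)
        (hcQ.intervalIntegrable _ _)]
      congr 1 with r
      rw [← map_add, ← add_apply, hPQ]
      rfl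
    have h2 := intervalIntegral.integral_interval_add_Ioi (hint S le_rfl) (hint s hs)
    have h3 := ((linearFlow M s).restrictScalars ℝ).intervalIntegral_comp_comm
      (hcP.intervalIntegrable (μ := MeasureTheory.volume) S s)
    have h4 := ((linearFlow M s).restrictScalars ℝ).integral_comp_comm (hint s hs)
    simp only [ContinuousLinearMap.coe_restrictScalars', hflow] at h3 h4
    rw [h3, h4, dichotomySolution, h1, ← h2, ← map_sub]
    congr 1
    abel
  have hbP : ‖∫ r in S..s, linearFlow M (s - r) (P (f r))‖ ≤
      ∫ r in S..s, C * N * rexp (-η * r) := by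
    refine intervalIntegral.norm_integral_le_of_norm_le hs (.of_forall fun r hr => ?_)
      (Continuous.intervalIntegrable (by fun_prop) _ _)
    have h1 := hP (s - r) (sub_nonneg.2 hr.2)
    rw [mul_assoc]
    exact ((linearFlow M (s - r) * P).le_opNorm (f r)).trans
      (mul_le_mul h1 (hfN r hr.1.le) (norm_nonneg _) ((norm_nonneg _).trans h1))
  have hbQ : ‖∫ r in Set.Ioi s, linearFlow M (s - r) (Q (f r))‖ ≤
      ∫ r in Set.Ioi s, C * N * rexp (-η * r) := by
    refine MeasureTheory.norm_integral_le_of_norm_le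
      ((exp_neg_integrableOn_Ioi s hη).const_mul (C * N)) ?_
    filter_upwards [MeasureTheory.ae_restrict_mem measurableSet_Ioi] with r hr
    exact norm_linearFlow_apply_le hQ hfN (hs.trans (le_of_lt hr)) (le_of_lt hr)
  have hsum := intervalIntegral.integral_interval_add_Ioi
    ((exp_neg_integrableOn_Ioi S hη).const_mul (C * N))
    ((exp_neg_integrableOn_Ioi s hη).const_mul (C * N))
  rw [hsplit]
  refine (norm_sub_le _ _).trans ((add_le_add hbP hbQ).trans (hsum.trans ?_).le)
  rw [MeasureTheory.integral_const_mul, integral_exp_mul_Ioi (neg_neg_of_pos hη), neg_div_neg_eq]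

lemma dichotomySolution_sub (hη : 0 < η) (hS : 0 ≤ S)
    (hQ : ∀ s, 0 ≤ s → ‖linearFlow M (-s) * Q‖ ≤ C)
    {f g : ℝ → E} (hf : Continuous f) (hfN : ∀ r, S ≤ r → ‖f r‖ ≤ N * rexp (-η * r))
    (hg : Continuous g) (hgN : ∀ r, S ≤ r → ‖g r‖ ≤ N * rexp (-η * r)) (s : ℝ) :
    dichotomySolution M Q S (fun r => f r - g r) s =
      dichotomySolution M Q S f s - dichotomySolution M Q S g s := by
  have hcf : Continuous fun r => linearFlow M (-r) (f r) := by fun_prop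
  have hcg : Continuous fun r => linearFlow M (-r) (g r) := by fun_prop
  have hif := integrableOn_linearFlow_apply hη hQ hf hfN le_rfl hS
  have hig := integrableOn_linearFlow_apply hη hQ hg hgN le_rfl hS
  simp only [zero_sub] at hif hig
  simp only [dichotomySolution, map_sub]
  rw [intervalIntegral.integral_sub (hcf.intervalIntegrable _ _) (hcg.intervalIntegrable _ _),
    MeasureTheory.integral_sub hif hig]
  simp only [map_sub]
  abel

open scoped BoundedContinuousFunction in
/-- If `M` has no purely imaginary eigenvalue and `h` is bounded and Lipschitz on the unit ball with
exponentially decaying constants, then `z' = M z + h(s, z)` has a solution in the unit ball near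
infinity. -/
theorem exists_solution_of_small_nonlinearity
    (hM : ∀ (z : ℂ) (v : E), z.re = 0 → M v = z • v → v = 0) (hη : 0 < η)
    {h : ℝ → E → E} (hcont : Continuous fun p : ℝ × E => h p.1 p.2) {S₀ : ℝ}
    (hbound : ∀ s z, S₀ ≤ s → ‖z‖ ≤ 1 → ‖h s z‖ ≤ N * rexp (-η * s))
    (hlip : ∀ s z w, S₀ ≤ s → ‖z‖ ≤ 1 → ‖w‖ ≤ 1 →
      ‖h s z - h s w‖ ≤ N * rexp (-η * s) * ‖z - w‖) :
    ∃ S, S₀ ≤ S ∧ ∃ z : ℝ → E, ∀ s, S < s →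
      HasDerivAt z (M (z s) + h s (z s)) s ∧ ‖z s‖ ≤ 1 := by
  have : CompleteSpace E := FiniteDimensional.complete ℂ E
  obtain ⟨C, P, Q, hPQ, hC⟩ := exists_exponential_dichotomy hM
  have hP s hs := (hC s hs).1
  have hQ s hs := (hC s hs).2
  obtain ⟨S, hS0, hS₀, hsmall⟩ : ∃ S, 0 ≤ S ∧ S₀ ≤ S ∧ C * N * (rexp (-η * S) / η) ≤ 1 / 2 := by
    have hlim : Tendsto (fun S => C * N * (rexp (-η * S) / η)) atTop (𝓝 (C * N * (0 / η))) := by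
      refine ((tendsto_exp_atBot.comp ?_).div_const η).const_mul _
      exact tendsto_id.const_mul_atTop_of_neg (neg_neg_of_pos hη)
    have h1 := hlim.eventually_le_const (u := 1 / 2) (by norm_num)
    obtain ⟨S, h⟩ := ((eventually_ge_atTop 0).and ((eventually_ge_atTop S₀).and h1)).exists
    exact ⟨S, h⟩
  let X := Metric.closedBall (0 : ℝ →ᵇ E) 1
  have : CompleteSpace X := Metric.isClosed_closedBall.completeSpace_coe
  have : Nonempty X := ⟨⟨0, by simp [X]⟩⟩
  have hX (z : X) (r : ℝ) : ‖(z : ℝ →ᵇ E) r‖ ≤ 1 :=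
    ((z : ℝ →ᵇ E).norm_coe_le_norm r).trans (mem_closedBall_zero_iff.1 z.2)
  let f (z : X) (r : ℝ) : E := h r ((z : ℝ →ᵇ E) r)
  have hf (z : X) : Continuous (f z) :=
    hcont.comp (continuous_id.prodMk (z : ℝ →ᵇ E).continuous)
  have hfN (z : X) (r : ℝ) (hr : S ≤ r) : ‖f z r‖ ≤ N * rexp (-η * r) :=
    hbound r _ (hS₀.trans hr) (hX z r)
  have hΦ (z : X) : Continuous fun s => dichotomySolution M Q S (f z) (max s S) :=
    (continuous_iff_continuousAt.2 fun s =>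
      (hasDerivAt_dichotomySolution M Q S (hf z) s).continuousAt).comp
      (continuous_id.max continuous_const)
  have hΦ1 (z : X) (s : ℝ) : ‖dichotomySolution M Q S (f z) (max s S)‖ ≤ 1 :=
    (norm_dichotomySolution_le hη hS0 hPQ hP hQ (hf z) (hfN z) (le_max_right s S)).trans
      (hsmall.trans (by norm_num))
  let Φ (z : X) : X := ⟨.ofNormedAddCommGroup _ (hΦ z) 1 (hΦ1 z), by
    simpa [X] using BoundedContinuousFunction.norm_ofNormedAddCommGroup_le _ zero_le_one (hΦ1 z)⟩
  have hcontr : ContractingWith (1 / 2) Φ := by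
    refine ⟨by norm_num, LipschitzWith.of_dist_le_mul fun z w => ?_⟩
    refine (BoundedContinuousFunction.dist_le (by positivity)).2 fun s => ?_
    rw [dist_eq_norm]
    change ‖dichotomySolution M Q S (f z) (max s S) - dichotomySolution M Q S (f w) (max s S)‖ ≤ _
    rw [← dichotomySolution_sub hη hS0 hQ (hf z) (hfN z) (hf w) (hfN w)]
    refine (norm_dichotomySolution_le (N := N * dist z w) hη hS0 hPQ hP hQ ((hf z).sub (hf w))
      (fun r hr => ?_) (le_max_right s S)).trans ?_
    · refine (hlip r _ _ (hS₀.trans hr) (hX z r) (hX w r)).trans ?_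
      have h1 : ‖(z : ℝ →ᵇ E) r - (w : ℝ →ᵇ E) r‖ ≤ dist z w := by
        rw [← dist_eq_norm]
        exact BoundedContinuousFunction.dist_coe_le_dist r
      have h2 : 0 ≤ N * rexp (-η * r) := (norm_nonneg _).trans (hfN z r hr)
      nlinarith
    · have := mul_le_mul_of_nonneg_right hsmall (dist_nonneg (x := z) (y := w))
      push_cast
      linarith
  let z := hcontr.fixedPoint Φ
  have hz (s : ℝ) (hs : S ≤ s) : (z : ℝ →ᵇ E) s = dichotomySolution M Q S (f z) s := by
    have h1 : Φ z = z := hcontr.fixedPoint_isFixedPt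
    have h2 : (Φ z : ℝ →ᵇ E) s = dichotomySolution M Q S (f z) (max s S) := rfl
    rwa [h1, max_eq_left hs] at h2
  refine ⟨S, hS₀, (z : ℝ →ᵇ E), fun s hs => ⟨?_, hX z s⟩⟩
  rw [hz s hs.le]
  have hder := hasDerivAt_dichotomySolution M Q S (hf z) s
  have heq : f z s = h s (dichotomySolution M Q S (f z) s) := by rw [← hz s hs.le]
  rw [heq] at hder
  refine hder.congr_of_eventuallyEq ?_
  filter_upwards [Ioi_mem_nhds hs] with r hr
  exact hz r (le_of_lt hr)

end LinearFlow

section RealSystem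

variable {n : ℕ}

/-- The real part of a complex vector. -/
def reVec (n : ℕ) : (Fin n → ℂ) →L[ℝ] EuclideanSpace ℝ (Fin n) :=
  LinearMap.toContinuousLinearMap
    { toFun := fun w => WithLp.toLp 2 fun i => (w i).re
      map_add' := fun v w => by ext i; simp
      map_smul' := fun c w => by ext i; simp }

/-- The inclusion of real vectors into complex vectors. -/
def ofRealVec (n : ℕ) : EuclideanSpace ℝ (Fin n) →L[ℝ] (Fin n → ℂ) :=
  LinearMap.toContinuousLinearMap
    { toFun := fun x i => (x i : ℂ)
      map_add' := fun v w => by ext i; simp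
      map_smul' := fun c w => by ext i; simp }

lemma reVec_apply (w : Fin n → ℂ) (i : Fin n) : reVec n w i = (w i).re := rfl

lemma ofRealVec_apply (x : EuclideanSpace ℝ (Fin n)) (i : Fin n) :
    ofRealVec n x i = (x i : ℂ) := rfl

lemma reVec_ofRealVec (x : EuclideanSpace ℝ (Fin n)) : reVec n (ofRealVec n x) = x := by
  ext i
  simp [reVec_apply, ofRealVec_apply]

/-- The complexification of a real matrix, as a continuous linear map. -/
def complexMulVec (A : Matrix (Fin n) (Fin n) ℝ) : (Fin n → ℂ) →L[ℂ] (Fin n → ℂ) :=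
  LinearMap.toContinuousLinearMap (A.map Complex.ofReal).mulVecLin

lemma reVec_complexMulVec (A : Matrix (Fin n) (Fin n) ℝ) (w : Fin n → ℂ) :
    reVec n (complexMulVec A w) = Matrix.toEuclideanLin A (reVec n w) := by
  ext i
  simp [reVec_apply, complexMulVec, Matrix.mulVec, dotProduct, Matrix.toLpLin_apply]

/-- The matrix of the first order system equivalent to `X'' = X' + A X`. -/
def firstOrderSystem (A : Matrix (Fin n) (Fin n) ℝ) :
    ((Fin n → ℂ) × (Fin n → ℂ)) →L[ℂ] ((Fin n → ℂ) × (Fin n → ℂ)) :=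
  (ContinuousLinearMap.snd ℂ _ _).prod
    (ContinuousLinearMap.snd ℂ _ _ + complexMulVec A ∘L ContinuousLinearMap.fst ℂ _ _)

lemma exists_weight_avoiding_spectrum {E : Type*} [NormedAddCommGroup E] [NormedSpace ℂ E]
    [FiniteDimensional ℂ E] (B : E →L[ℂ] E) {a b : ℝ} (hab : a < b) :
    ∃ μ ∈ Set.Ioo a b, ∀ (z : ℂ) (v : E), z.re = 0 →
      (B + (μ : ℂ) • (1 : E →L[ℂ] E)) v = z • v → v = 0 := by
  have hfin : (Set.image (fun z : ℂ => -z.re)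
      {z | Module.End.HasEigenvalue (B : E →ₗ[ℂ] E) z}).Finite :=
    (Module.End.finite_hasEigenvalue _).image _
  obtain ⟨μ, hμ, hμB⟩ := (Set.Ioo_infinite hab).exists_notMem_finite hfin
  refine ⟨μ, hμ, fun z v hz hv => ?_⟩
  by_contra hv0
  refine hμB ⟨z - μ, Module.End.hasEigenvalue_of_hasEigenvector (x := v) ⟨?_, hv0⟩, by simp [hz]⟩
  rw [Module.End.mem_eigenspace_iff]
  simp only [add_apply, smul_apply, one_apply_eq_self] at hv
  rw [sub_smul, ← hv]
  simp

/-- In the variable `s = log t` and after rescaling by `exp (μ s)`, the nonlinearity of the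
first order system. -/
def rescaledNonlinearity (F : ℝ → EuclideanSpace ℝ (Fin n) → EuclideanSpace ℝ (Fin n)) (μ : ℝ)
    (s : ℝ) (z : (Fin n → ℂ) × (Fin n → ℂ)) : (Fin n → ℂ) × (Fin n → ℂ) :=
  (0, rexp ((2 + μ) * s) • ofRealVec n (F (rexp s) (rexp (-μ * s) • reVec n z.1)))

variable {F : ℝ → EuclideanSpace ℝ (Fin n) → EuclideanSpace ℝ (Fin n)} {κ μ : ℝ}

lemma continuous_rescaledNonlinearity
    (hFcont : ContinuousOn (fun p : ℝ × EuclideanSpace ℝ (Fin n) => F p.1 p.2)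
      (Set.Ioi (0:ℝ) ×ˢ Set.univ)) :
    Continuous fun p : ℝ × ((Fin n → ℂ) × (Fin n → ℂ)) => rescaledNonlinearity F μ p.1 p.2 := by
  have h1 : Continuous fun p : ℝ × ((Fin n → ℂ) × (Fin n → ℂ)) =>
      F (rexp p.1) (rexp (-μ * p.1) • reVec n p.2.1) :=
    hFcont.comp_continuous
      (f := fun p : ℝ × ((Fin n → ℂ) × (Fin n → ℂ)) =>
        (rexp p.1, rexp (-μ * p.1) • reVec n p.2.1))
      (by fun_prop) fun p => ⟨exp_pos _, Set.mem_univ _⟩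
  have h2 : Continuous fun p : ℝ × ((Fin n → ℂ) × (Fin n → ℂ)) => rexp ((2 + μ) * p.1) := by
    fun_prop
  exact continuous_const.prodMk (h2.smul ((ofRealVec n).continuous.comp h1))

lemma exp_mul_rpow_exp (κ μ s : ℝ) :
    rexp ((2 + μ) * s) * rexp s ^ (-2 - κ) = rexp (-(κ - μ) * s) := by
  rw [← exp_mul, ← exp_add]
  congr 1
  ring

lemma norm_smul_reVec_le {s : ℝ} (hs : rexp (-μ * s) * ‖reVec n‖ ≤ 1)
    {z : (Fin n → ℂ) × (Fin n → ℂ)} :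
    ‖rexp (-μ * s) • reVec n z.1‖ ≤ ‖z‖ := by
  rw [norm_smul, norm_of_nonneg (exp_pos _).le]
  calc rexp (-μ * s) * ‖reVec n z.1‖ ≤ rexp (-μ * s) * (‖reVec n‖ * ‖z.1‖) := by
        gcongr; exact (reVec n).le_opNorm _
    _ = rexp (-μ * s) * ‖reVec n‖ * ‖z.1‖ := by ring
    _ ≤ 1 * ‖z‖ := by gcongr; exact norm_fst_le z
    _ = ‖z‖ := one_mul _

lemma norm_rescaledNonlinearity_le
    (hFbound : ∀ t : ℝ, 0 < t → ∀ x : EuclideanSpace ℝ (Fin n), ‖x‖ ≤ 1 →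
      ‖F t x‖ + ‖fderiv ℝ (F t) x‖ ≤ t ^ (-2 - κ))
    {s : ℝ} (hs : rexp (-μ * s) * ‖reVec n‖ ≤ 1) {z : (Fin n → ℂ) × (Fin n → ℂ)} (hz : ‖z‖ ≤ 1) :
    ‖rescaledNonlinearity F μ s z‖ ≤ ‖ofRealVec n‖ * rexp (-(κ - μ) * s) := by
  have hF := hFbound (rexp s) (exp_pos s) _ ((norm_smul_reVec_le hs).trans hz)
  have hF' := (le_add_of_nonneg_right (norm_nonneg _)).trans hF
  rw [rescaledNonlinearity, Prod.norm_mk, norm_zero, max_eq_right (norm_nonneg _), norm_smul,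
    norm_of_nonneg (exp_pos _).le, ← exp_mul_rpow_exp κ μ s]
  calc _ ≤ rexp ((2 + μ) * s) * (‖ofRealVec n‖ * rexp s ^ (-2 - κ)) := by
        gcongr
        exact (ofRealVec n).le_opNorm_of_le hF'
    _ = _ := by ring

lemma norm_rescaledNonlinearity_sub_le (hFdiff : ∀ t : ℝ, 0 < t → ContDiff ℝ 1 (F t))
    (hFbound : ∀ t : ℝ, 0 < t → ∀ x : EuclideanSpace ℝ (Fin n), ‖x‖ ≤ 1 →
      ‖F t x‖ + ‖fderiv ℝ (F t) x‖ ≤ t ^ (-2 - κ))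
    {s : ℝ} (hs : rexp (-μ * s) * ‖reVec n‖ ≤ 1) {z w : (Fin n → ℂ) × (Fin n → ℂ)}
    (hz : ‖z‖ ≤ 1) (hw : ‖w‖ ≤ 1) :
    ‖rescaledNonlinearity F μ s z - rescaledNonlinearity F μ s w‖ ≤
      ‖ofRealVec n‖ * rexp (-(κ - μ) * s) * ‖z - w‖ := by
  have hF : ‖F (rexp s) (rexp (-μ * s) • reVec n z.1) -
      F (rexp s) (rexp (-μ * s) • reVec n w.1)‖ ≤ rexp s ^ (-2 - κ) * ‖z - w‖ := by
    refine (Convex.norm_image_sub_le_of_norm_fderiv_le (𝕜 := ℝ)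
      (s := Metric.closedBall (0 : EuclideanSpace ℝ (Fin n)) 1) (C := rexp s ^ (-2 - κ))
      (fun x _ => ((hFdiff _ (exp_pos s)).differentiable one_ne_zero).differentiableAt)
      (fun x hx => (le_add_of_nonneg_left (norm_nonneg _)).trans
        (hFbound _ (exp_pos s) x (mem_closedBall_zero_iff.1 hx)))
      (convex_closedBall _ _)
      (mem_closedBall_zero_iff.2 ((norm_smul_reVec_le hs).trans hw))
      (mem_closedBall_zero_iff.2 ((norm_smul_reVec_le hs).trans hz))).trans ?_
    rw [← smul_sub, ← map_sub, ← Prod.fst_sub]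
    gcongr
    exact norm_smul_reVec_le hs
  rw [rescaledNonlinearity, rescaledNonlinearity, Prod.mk_sub_mk, sub_zero, Prod.norm_mk,
    norm_zero, max_eq_right (norm_nonneg _), ← smul_sub, ← map_sub, norm_smul,
    norm_of_nonneg (exp_pos _).le, ← exp_mul_rpow_exp κ μ s]
  calc _ ≤ rexp ((2 + μ) * s) * (‖ofRealVec n‖ * (rexp s ^ (-2 - κ) * ‖z - w‖)) := by
        gcongr
        exact (ofRealVec n).le_opNorm_of_le hF
    _ = _ := by ring

lemma hasDerivAt_real_system_of_rescaled {A : Matrix (Fin n) (Fin n) ℝ}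
    {z : ℝ → (Fin n → ℂ) × (Fin n → ℂ)} {s : ℝ}
    (hz : HasDerivAt z ((firstOrderSystem A + (μ : ℂ) • 1) (z s) +
      rescaledNonlinearity F μ s (z s)) s) :
    HasDerivAt (fun r => rexp (-μ * r) • reVec n (z r).1) (rexp (-μ * s) • reVec n (z s).2) s ∧
    HasDerivAt (fun r => rexp (-μ * r) • reVec n (z r).2)
      (rexp (-μ * s) • reVec n (z s).2 +
        Matrix.toEuclideanLin A (rexp (-μ * s) • reVec n (z s).1) +
        rexp (2 * s) • F (rexp s) (rexp (-μ * s) • reVec n (z s).1)) s := by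
  have hexp : HasDerivAt (fun r => rexp (-μ * r)) (rexp (-μ * s) * -μ) s := by
    have h1 : HasDerivAt (fun r : ℝ => -μ * r) (-μ) s := by
      simpa using (hasDerivAt_id s).const_mul (-μ)
    exact h1.exp
  have h1 := (reVec n).hasFDerivAt.comp_hasDerivAt s
    ((ContinuousLinearMap.fst ℝ _ _).hasFDerivAt.comp_hasDerivAt s hz)
  have h2 := (reVec n).hasFDerivAt.comp_hasDerivAt s
    ((ContinuousLinearMap.snd ℝ _ _).hasFDerivAt.comp_hasDerivAt s hz)
  have hcancel : rexp (2 * s) = rexp (-μ * s) * rexp ((2 + μ) * s) := by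
    rw [← exp_add]
    congr 1
    ring
  constructor
  · refine (hexp.smul h1).congr_deriv ?_
    simp [firstOrderSystem, rescaledNonlinearity]
    module
  · refine (hexp.smul h2).congr_deriv ?_
    rw [hcancel]
    simp [firstOrderSystem, rescaledNonlinearity, reVec_complexMulVec, reVec_ofRealVec]
    module

end RealSystem

/-- existence of a decaying solution of the perturbed Euler-type ODE
`ẍ = A x / t² + F(t,x)`. -/
theorem ode_decaying_solution
    (n : ℕ) (A : Matrix (Fin n) (Fin n) ℝ) (δ κ : ℝ) (hδ : 0 < δ) (hδκ : δ < κ)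
    (F : ℝ → EuclideanSpace ℝ (Fin n) → EuclideanSpace ℝ (Fin n))
    (hFcont : ContinuousOn (fun p : ℝ × EuclideanSpace ℝ (Fin n) => F p.1 p.2)
      (Set.Ioi (0:ℝ) ×ˢ Set.univ))
    (hFdiff : ∀ t : ℝ, 0 < t → ContDiff ℝ 1 (F t))
    (hFbound : ∀ t : ℝ, 0 < t → ∀ x : EuclideanSpace ℝ (Fin n), ‖x‖ ≤ 1 →
      ‖F t x‖ + ‖fderiv ℝ (F t) x‖ ≤ t ^ (-2 - κ)) :
    ∃ T : ℝ, 0 < T ∧ ∃ x v : ℝ → EuclideanSpace ℝ (Fin n),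
      ∀ t ∈ Set.Ici T,
        HasDerivAt x (v t) t ∧
        HasDerivAt v ((t ^ 2)⁻¹ • Matrix.toEuclideanLin A (x t) + F t (x t)) t ∧
        ‖x t‖ ≤ t ^ (-δ) := by
  obtain ⟨μ, ⟨hδμ, hμκ⟩, hμ⟩ := exists_weight_avoiding_spectrum (firstOrderSystem A) hδκ
  have hlim {a : ℝ} (ha : 0 < a) : ∀ᶠ s in atTop, rexp (-a * s) * ‖reVec n‖ ≤ 1 := by
    have h1 : Tendsto (fun s => rexp (-a * s) * ‖reVec n‖) atTop (𝓝 (0 * ‖reVec n‖)) :=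
      (tendsto_exp_atBot.comp
        (tendsto_id.const_mul_atTop_of_neg (neg_neg_of_pos ha))).mul_const _
    exact h1.eventually_le_const (by norm_num)
  obtain ⟨S₀, hS₀⟩ := eventually_atTop.1 ((hlim (hδ.trans hδμ)).and (hlim (sub_pos.2 hδμ)))
  obtain ⟨S, hS₀S, z, hz⟩ := exists_solution_of_small_nonlinearity
    (h := rescaledNonlinearity F μ) (S₀ := S₀) hμ (sub_pos.2 hμκ)
    (continuous_rescaledNonlinearity hFcont)
    (fun s z hs => norm_rescaledNonlinearity_le hFbound (hS₀ s hs).1)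
    (fun s z w hs => norm_rescaledNonlinearity_sub_le hFdiff hFbound (hS₀ s hs).1)
  refine ⟨rexp (S + 1), exp_pos _, fun t => rexp (-μ * log t) • reVec n (z (log t)).1,
    fun t => t⁻¹ • rexp (-μ * log t) • reVec n (z (log t)).2, fun t ht => ?_⟩
  have ht0 : 0 < t := (exp_pos _).trans_le ht
  have hlog : S < log t := by
    have := (le_log_iff_exp_le ht0).2 ht
    linarith
  obtain ⟨hder, hnorm⟩ := hz _ hlog
  obtain ⟨hx, hv⟩ := hasDerivAt_real_system_of_rescaled hder
  have hl := hasDerivAt_log ht0.ne'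
  refine ⟨hx.scomp t hl, ?_, ?_⟩
  · refine ((hasDerivAt_inv ht0.ne').smul (hv.scomp t hl)).congr_deriv ?_
    have hexp2 : rexp (2 * log t) = t ^ 2 := by
      rw [two_mul, exp_add, exp_log ht0, sq]
    rw [hexp2, exp_log ht0]
    simp only [Function.comp_apply]
    generalize Matrix.toEuclideanLin A _ = a
    match_scalars <;> field_simp
    ring
  · have hsplit : rexp (-μ * log t) = t ^ (-δ) * rexp (-(μ - δ) * log t) := by
      rw [rpow_def_of_pos ht0, ← exp_add]
      congr 1
      ring
    have hS := (hS₀ (log t) (hS₀S.trans hlog.le)).2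
    beta_reduce
    rw [hsplit, mul_smul, norm_smul, norm_of_nonneg (rpow_nonneg ht0.le _)]
    exact mul_le_of_le_one_right (rpow_nonneg ht0.le _) ((norm_smul_reVec_le hS).trans hnorm)

end
end

section
/- Let m ≥ 2, T ≥ 1, and let α_j ∈ C¹([T,∞); ℝ³) (1 ≤ j ≤ m). Let 𝒫 be a partition of {1,…,m} into classes, and assume there are constants 0 < c₀ < C₀ such that for all t ≥ T: |α̇_j(t)| ≤ C₀ for all j; c₀ t^{2/3} ≤ |α_j(t) − α_k(t)| ≤ C₀ t^{2/3} for all j ≠ k in the same class; and |α_j(t) − α_k(t)| ≥ c₀ t for all j, k in different classes. Then there exist T' ≥ T, constants c, C > 0, and functions φ_j : [T',∞) × ℝ³ → ℝ (1 ≤ j ≤ m), C¹ in t and C^∞ in x, such that: 0 ≤ φ_j ≤ 1; ∑_{j=1}^m φ_j ≡ 1; |∂_t φ_j| + |∇_x φ_j| ≤ C t^{−2/3} and |∂_t √φ_j| + |∇_x √φ_j| ≤ C t^{−2/3}; φ_j(t,x) = 1 whenever |x − α_j(t)| ≤ c t^{2/3}; φ_j(t,x) = 0 whenever |x − α_k(t)|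 ≤ c t^{2/3} for some k ≠ j; and moreover, for every class J ∈ 𝒫, the function φ_J = ∑_{j∈J} φ_j satisfies |∂_t φ_J| + |∇_x φ_J| ≤ C t^{−1}. -/
open Filter Real
open scoped Topology BigOperators

noncomputable section

section Cutoff

variable {E : Type*} [NormedAddCommGroup E]

/-- A time-dependent function with values in `[0, 1]` on `[T, ∞) × E`, which is `C¹` in time, smooth
in space, and whose first derivatives are bounded by a constant multiple of `r t`. -/
structure IsCutoffWithRate [NormedSpace ℝ E] (T : ℝ) (r : ℝ → ℝ) (f : ℝ → E → ℝ) : Prop where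
  contDiffOn_time : ∀ x, ContDiffOn ℝ 1 (fun t => f t x) (Set.Ici T)
  contDiff_space : ∀ t ∈ Set.Ici T, ContDiff ℝ (⊤ : ℕ∞) (f t)
  mem_Icc : ∀ t ∈ Set.Ici T, ∀ x, f t x ∈ Set.Icc (0 : ℝ) 1
  exists_bound : ∃ D : ℝ, ∀ t ∈ Set.Ici T, ∀ x,
    |derivWithin (fun s => f s x) (Set.Ici T) t| + ‖fderiv ℝ (f t) x‖ ≤ D * r t

namespace IsCutoffWithRate

variable [NormedSpace ℝ E] {T : ℝ} {r r' : ℝ → ℝ} {f g : ℝ → E → ℝ}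

theorem one (T : ℝ) (r : ℝ → ℝ) : IsCutoffWithRate T r (fun _ (_ : E) => 1) where
  contDiffOn_time _ := contDiffOn_const
  contDiff_space _ _ := contDiff_const
  mem_Icc _ _ _ := by simp
  exists_bound := ⟨0, fun t _ x => by simp⟩

theorem congr (hf : IsCutoffWithRate T r f) (h : ∀ t ∈ Set.Ici T, ∀ x, g t x = f t x) :
    IsCutoffWithRate T r g where
  contDiffOn_time x := (hf.contDiffOn_time x).congr fun t ht => h t ht x
  contDiff_space t ht := by
    rw [show g t = f t from funext (h t ht)]
    exact hf.contDiff_space t ht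
  mem_Icc t ht x := h t ht x ▸ hf.mem_Icc t ht x
  exists_bound := by
    obtain ⟨D, hD⟩ := hf.exists_bound
    refine ⟨D, fun t ht x => ?_⟩
    rw [show g t = f t from funext (h t ht),
      derivWithin_congr (fun s hs => h s hs x) (h t ht x)]
    exact hD t ht x

theorem mul (hf : IsCutoffWithRate T r f) (hg : IsCutoffWithRate T r g) :
    IsCutoffWithRate T r (fun t x => f t x * g t x) where
  contDiffOn_time x := (hf.contDiffOn_time x).mul (hg.contDiffOn_time x)
  contDiff_space t ht := (hf.contDiff_space t ht).mul (hg.contDiff_space t ht)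
  mem_Icc t ht x := by
    obtain ⟨h0, h1⟩ := hf.mem_Icc t ht x
    obtain ⟨h2, h3⟩ := hg.mem_Icc t ht x
    exact ⟨mul_nonneg h0 h2, mul_le_one₀ h1 h2 h3⟩
  exists_bound := by
    obtain ⟨D, hD⟩ := hf.exists_bound
    obtain ⟨D', hD'⟩ := hg.exists_bound
    refine ⟨D + D', fun t ht x => ?_⟩
    have hft := (hf.contDiffOn_time x).differentiableOn one_ne_zero t ht
    have hgt := (hg.contDiffOn_time x).differentiableOn one_ne_zero t ht
    have hfx := (hf.contDiff_space t ht).differentiable (by simp) x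
    have hgx := (hg.contDiff_space t ht).differentiable (by simp) x
    obtain ⟨h0, h1⟩ := hf.mem_Icc t ht x
    obtain ⟨h2, h3⟩ := hg.mem_Icc t ht x
    have htime : |derivWithin (fun s => f s x * g s x) (Set.Ici T) t| ≤
        |derivWithin (fun s => f s x) (Set.Ici T) t| +
          |derivWithin (fun s => g s x) (Set.Ici T) t| := by
      rw [derivWithin_fun_mul hft hgt]
      refine (abs_add_le _ _).trans (add_le_add ?_ ?_)
      · rw [abs_mul, abs_of_nonneg h2]
        exact mul_le_of_le_one_right (abs_nonneg _) h3
      · rw [abs_mul, abs_of_nonneg h0]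
        exact mul_le_of_le_one_left (abs_nonneg _) h1
    have hspace : ‖fderiv ℝ (fun y => f t y * g t y) x‖ ≤
        ‖fderiv ℝ (f t) x‖ + ‖fderiv ℝ (g t) x‖ := by
      rw [fderiv_fun_mul hfx hgx, add_comm]
      refine (norm_add_le _ _).trans (add_le_add ?_ ?_)
      · rw [norm_smul, Real.norm_of_nonneg h2]
        exact mul_le_of_le_one_left (norm_nonneg _) h3
      · rw [norm_smul, Real.norm_of_nonneg h0]
        exact mul_le_of_le_one_left (norm_nonneg _) h1
    linarith [hD t ht x, hD' t ht x]

theorem mono_rate (hf : IsCutoffWithRate T r f)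
    (h : ∀ t ∈ Set.Ici T, 0 ≤ r t ∧ r t ≤ r' t) : IsCutoffWithRate T r' f where
  contDiffOn_time := hf.contDiffOn_time
  contDiff_space := hf.contDiff_space
  mem_Icc := hf.mem_Icc
  exists_bound := by
    obtain ⟨D, hD⟩ := hf.exists_bound
    refine ⟨|D|, fun t ht x => (hD t ht x).trans ?_⟩
    exact (mul_le_mul_of_nonneg_right (le_abs_self D) (h t ht).1).trans
      (mul_le_mul_of_nonneg_left (h t ht).2 (abs_nonneg D))

theorem eventually_bound (hf : IsCutoffWithRate T r f) (hr : ∀ t ∈ Set.Ici T, 0 ≤ r t) :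
    ∀ᶠ C : ℝ in atTop, ∀ t ∈ Set.Ici T, ∀ x,
      |derivWithin (fun s => f s x) (Set.Ici T) t| + ‖fderiv ℝ (f t) x‖ ≤ C * r t := by
  obtain ⟨D, hD⟩ := hf.exists_bound
  filter_upwards [eventually_ge_atTop D] with C hC t ht x
  exact (hD t ht x).trans (mul_le_mul_of_nonneg_right hC (hr t ht))

/-- Rescaling a fixed profile around a moving centre of bounded speed. -/
theorem comp_rescale {β : ℝ → E} {K p : ℝ} (hT : 1 ≤ T) (hp0 : 0 ≤ p) (hp : p ≤ 1)
    (hβ : ContDiffOn ℝ 1 β (Set.Ici T))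
    (hK : ∀ t ∈ Set.Ici T, ‖derivWithin β (Set.Ici T) t‖ ≤ K)
    {G : E → ℝ} (hG : ContDiff ℝ (⊤ : ℕ∞) G) (hGc : HasCompactSupport (fderiv ℝ G))
    (hG01 : ∀ y, G y ∈ Set.Icc (0 : ℝ) 1) :
    IsCutoffWithRate T (fun t => t ^ (-p)) (fun t x => G (t ^ (-p) • (x - β t))) := by
  have hpos : ∀ t ∈ Set.Ici T, 0 < t := fun t ht => by
    have : T ≤ t := ht
    linarith
  have hcont : Continuous (fderiv ℝ G) := hG.continuous_fderiv (by simp)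
  obtain ⟨L, hL⟩ := hcont.bounded_above_of_compact_support hGc
  obtain ⟨M, hM⟩ : ∃ M, ∀ y, ‖‖y‖ • fderiv ℝ G y‖ ≤ M :=
    (continuous_norm.smul hcont).bounded_above_of_compact_support hGc.smul_left
  have hGdiff : Differentiable ℝ G := hG.differentiable (by simp)
  have hL0 : 0 ≤ L := (norm_nonneg _).trans (hL 0)
  refine ⟨fun x => ?_, fun t ht => ?_, fun t ht x => hG01 _, L * K + M + L, fun t ht x => ?_⟩
  · refine (hG.of_le (by exact_mod_cast le_top)).comp_contDiffOn (ContDiffOn.smul ?_ ?_)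
    · exact contDiffOn_id.rpow_const_of_ne fun t ht => (hpos t ht).ne'
    · exact contDiffOn_const.sub hβ
  · exact hG.comp (contDiff_const.smul (contDiff_id.sub contDiff_const))
  · have ht0 := hpos t ht
    have ht1 : 1 ≤ t := hT.trans ht
    have hs : 0 < t ^ (-p) := rpow_pos_of_pos ht0 _
    set y := t ^ (-p) • (x - β t) with hy
    set β' := derivWithin β (Set.Ici T) t with hβ'
    have hβd : HasDerivWithinAt β β' (Set.Ici T) t :=
      (hβ.differentiableOn one_ne_zero t ht).hasDerivWithinAt
    have hsd : HasDerivWithinAt (fun s : ℝ => s ^ (-p)) (-p * t ^ (-p - 1)) (Set.Ici T) t :=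
      (Real.hasDerivAt_rpow_const (Or.inl ht0.ne')).hasDerivWithinAt
    have hyd := hsd.smul (hβd.const_sub x)
    have htime := ((hGdiff y).hasFDerivAt.comp_hasDerivWithinAt t hyd).derivWithin
      (uniqueDiffOn_Ici T t ht)
    have hspace : HasFDerivAt (fun z => G (t ^ (-p) • (z - β t)))
        ((fderiv ℝ G y).comp (t ^ (-p) • ContinuousLinearMap.id ℝ E)) x :=
      (hGdiff y).hasFDerivAt.comp x (((hasFDerivAt_id x).sub_const (β t)).const_smul (t ^ (-p)))
    have hsplit : t ^ (-p) • -β' + (-p * t ^ (-p - 1)) • (x - β t) =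
        t ^ (-p) • -β' + (-p * t⁻¹) • y := by
      rw [hy, smul_smul, rpow_sub_one ht0.ne']
      congr 2
      field_simp
    have hrate : t⁻¹ ≤ t ^ (-p) := by
      rw [← rpow_neg_one]
      exact rpow_le_rpow_of_exponent_le ht1 (by linarith)
    have hb1 : |fderiv ℝ G y (t ^ (-p) • -β')| ≤ L * K * t ^ (-p) := by
      rw [← Real.norm_eq_abs]
      refine ((fderiv ℝ G y).le_of_opNorm_le (hL y) _).trans ?_
      rw [norm_smul, norm_neg, Real.norm_of_nonneg hs.le, mul_assoc, mul_comm K]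
      gcongr
      exact hK t ht
    have hb2 : |fderiv ℝ G y ((-p * t⁻¹) • y)| ≤ M * t ^ (-p) := by
      have h1 : |fderiv ℝ G y y| ≤ M := by
        refine ((fderiv ℝ G y).le_opNorm y).trans ?_
        have := hM y
        rwa [norm_smul, norm_norm, mul_comm] at this
      rw [map_smul, smul_eq_mul, abs_mul, mul_comm]
      refine mul_le_mul h1 ?_ (abs_nonneg _) ((abs_nonneg _).trans h1)
      rw [abs_mul, abs_neg, abs_of_nonneg hp0, abs_of_pos (inv_pos.2 ht0)]
      exact (mul_le_of_le_one_left (inv_pos.2 ht0).le hp).trans hrate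
    have hb3 : ‖(fderiv ℝ G y).comp (t ^ (-p) • ContinuousLinearMap.id ℝ E)‖ ≤ L * t ^ (-p) := by
      rw [ContinuousLinearMap.comp_smul, ContinuousLinearMap.comp_id, norm_smul,
        Real.norm_of_nonneg hs.le, mul_comm]
      exact mul_le_mul_of_nonneg_right (hL y) hs.le
    have htime' : |derivWithin (fun s => G (s ^ (-p) • (x - β s))) (Set.Ici T) t| ≤
        L * K * t ^ (-p) + M * t ^ (-p) := by
      have heq : derivWithin (fun s => G (s ^ (-p) • (x - β s))) (Set.Ici T) t =
          fderiv ℝ G y (t ^ (-p) • -β' + (-p * t ^ (-p - 1)) • (x - β t)) := htime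
      rw [heq, hsplit, map_add]
      exact (abs_add_le _ _).trans (add_le_add hb1 hb2)
    rw [hspace.fderiv]
    linarith

end IsCutoffWithRate

/-- A quadratic partition of unity on `E` separating a ball from the complement of its double. -/
theorem exists_sq_add_sq_eq_one_profile (E : Type*) [NormedAddCommGroup E] [InnerProductSpace ℝ E]
    [FiniteDimensional ℝ E] {c : ℝ} (hc : 0 < c) :
    ∃ U V : E → ℝ,
      (ContDiff ℝ (⊤ : ℕ∞) U ∧ HasCompactSupport (fderiv ℝ U) ∧ ∀ y, U y ∈ Set.Icc (0 : ℝ) 1) ∧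
      (ContDiff ℝ (⊤ : ℕ∞) V ∧ HasCompactSupport (fderiv ℝ V) ∧ ∀ y, V y ∈ Set.Icc (0 : ℝ) 1) ∧
      (∀ y, U y ^ 2 + V y ^ 2 = 1) ∧ (∀ y, ‖y‖ ≤ c → U y = 1) ∧
      (∀ y, 2 * c ≤ ‖y‖ → V y = 1) := by
  let f : ContDiffBump (0 : E) := ⟨c, 2 * c, hc, by linarith⟩
  have hf : ContDiff ℝ (⊤ : ℕ∞) f := f.contDiff
  have hfc : HasCompactSupport f := f.hasCompactSupport
  have hθ : ∀ y, 0 ≤ π / 2 * f y ∧ π / 2 * f y ≤ π / 2 := fun y =>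
    ⟨mul_nonneg (by positivity) f.nonneg, mul_le_of_le_one_right (by positivity) f.le_one⟩
  refine ⟨fun y => sin (π / 2 * f y), fun y => cos (π / 2 * f y),
    ⟨contDiff_sin.comp (contDiff_const.mul hf), ?_, fun y => ⟨?_, sin_le_one _⟩⟩,
    ⟨contDiff_cos.comp (contDiff_const.mul hf), ?_, fun y => ⟨?_, cos_le_one _⟩⟩,
    fun y => sin_sq_add_cos_sq _, fun y hy => ?_, fun y hy => ?_⟩
  · exact (hfc.comp_left (g := fun z => sin (π / 2 * z)) (by simp)).fderiv ℝ
  · exact sin_nonneg_of_nonneg_of_le_pi (hθ y).1 (by linarith [(hθ y).2, pi_pos])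
  · have h := (hfc.comp_left (g := fun z => cos (π / 2 * z) - 1) (by simp)).fderiv ℝ
    convert h using 1
    ext1 y
    exact (fderiv_sub_const (f := fun y => cos (π / 2 * f y)) 1).symm
  · exact cos_nonneg_of_neg_pi_div_two_le_of_le (by linarith [(hθ y).1, pi_pos]) (hθ y).2
  · have : f y = 1 := f.one_of_mem_closedBall (by simpa [f] using hy)
    simp [this]
  · have : f y = 0 := f.zero_of_le_dist (by simpa [f] using hy)
    simp [this]

variable [InnerProductSpace ℝ E] [FiniteDimensional ℝ E]

/-- A quadratic partition of unity adapted to finitely many moving centres of bounded speed whose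
mutual distances are at least of order `t ^ p`. -/
theorem exists_quadratic_partition {ι : Type*} (S : Finset ι) (hS : S.Nonempty)
    {T K p c : ℝ} (hT : 1 ≤ T) (hp0 : 0 ≤ p) (hp : p ≤ 1) (hc : 0 < c) {β : ι → ℝ → E}
    (hβ : ∀ i, ContDiffOn ℝ 1 (β i) (Set.Ici T))
    (hK : ∀ i, ∀ t ∈ Set.Ici T, ‖derivWithin (β i) (Set.Ici T) t‖ ≤ K)
    (hsep : ∀ t ∈ Set.Ici T, ∀ i ∈ S, ∀ k ∈ S, i ≠ k → 3 * c * t ^ p ≤ ‖β i t - β k t‖) :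
    ∃ b : ι → ℝ → E → ℝ, (∀ i, IsCutoffWithRate T (fun t => t ^ (-p)) (b i)) ∧
      (∀ t ∈ Set.Ici T, ∀ x, ∑ i ∈ S, b i t x ^ 2 = 1) ∧
      ∀ i ∈ S, ∀ t ∈ Set.Ici T, ∀ x, ‖x - β i t‖ ≤ c * t ^ p → b i t x = 1 := by
  classical
  induction hS using Finset.Nonempty.cons_induction with
  | singleton a =>
    exact ⟨fun _ _ _ => 1, fun _ => .one _ _, by simp, by simp⟩
  | cons a S ha hS ih =>
    obtain ⟨b, hb, hsum, hone⟩ := ih fun t ht i hi k hk =>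
      hsep t ht i (Finset.mem_cons_of_mem hi) k (Finset.mem_cons_of_mem hk)
    obtain ⟨U, V, ⟨hU, hUc, hU01⟩, ⟨hV, hVc, hV01⟩, hUV, hU1, hV1⟩ :=
      exists_sq_add_sq_eq_one_profile E hc
    have hu := IsCutoffWithRate.comp_rescale hT hp0 hp (hβ a) (hK a) hU hUc hU01
    have hv := IsCutoffWithRate.comp_rescale hT hp0 hp (hβ a) (hK a) hV hVc hV01
    have hne : ∀ i ∈ S, i ≠ a := fun i hi h => ha (h ▸ hi)
    have hnorm : ∀ t ∈ Set.Ici T, ∀ x,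
        0 < t ^ p ∧ ‖t ^ (-p) • (x - β a t)‖ = ‖x - β a t‖ / t ^ p := fun t ht x => by
      have ht0 : 0 < t := lt_of_lt_of_le one_pos (hT.trans ht)
      refine ⟨rpow_pos_of_pos ht0 _, ?_⟩
      rw [norm_smul, Real.norm_of_nonneg (rpow_pos_of_pos ht0 _).le, rpow_neg ht0.le]
      field_simp
    refine ⟨fun i => if i = a then fun t x => U (t ^ (-p) • (x - β a t)) else
      fun t x => V (t ^ (-p) • (x - β a t)) * b i t x, fun i => ?_, fun t ht x => ?_, ?_⟩
    · by_cases h : i = a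
      · simpa only [if_pos h] using hu
      · simpa only [if_neg h] using hv.mul (hb i)
    · rw [Finset.sum_cons, Finset.sum_congr rfl fun i hi => show _ =
        V (t ^ (-p) • (x - β a t)) ^ 2 * b i t x ^ 2 by simp only [if_neg (hne i hi), mul_pow],
        ← Finset.mul_sum, hsum t ht x, mul_one]
      simp only [if_true]
      exact hUV _
    · intro i hi t ht x hx
      obtain ⟨hs, hn⟩ := hnorm t ht x
      rcases Finset.mem_cons.1 hi with rfl | hiS
      · simp only [if_true]
        exact hU1 _ (by rwa [hn, div_le_iff₀ hs])
      · simp only [if_neg (hne i hiS)]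
        rw [hone i hiS t ht x hx, mul_one]
        refine hV1 _ ?_
        rw [hn, le_div_iff₀ hs]
        have h1 := hsep t ht i hi a (Finset.mem_cons_self a S) (hne i hiS)
        have h2 : ‖β i t - β a t‖ ≤ ‖x - β a t‖ + ‖x - β i t‖ := by
          rw [show β i t - β a t = (x - β a t) - (x - β i t) by abel]
          exact norm_sub_le _ _
        linarith

end Cutoff

/-- partition of unity adapted to a hyperbolic-parabolic family of
trajectories, grouped into classes (the partition is encoded by the label map `cls`). -/
theorem cutoff_partition_of_unity_mixed
    (m : ℕ) (hm : 2 ≤ m) (T : ℝ) (hT : 1 ≤ T)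
    (α : Fin m → ℝ → E3) (cls : Fin m → ℕ) (c₀ C₀ : ℝ) (hc₀ : 0 < c₀) (hc₀C₀ : c₀ < C₀)
    (hα : ∀ j, ContDiffOn ℝ 1 (α j) (Set.Ici T))
    (hvel : ∀ j, ∀ t ∈ Set.Ici T, ‖derivWithin (α j) (Set.Ici T) t‖ ≤ C₀)
    (hsep_same : ∀ t ∈ Set.Ici T, ∀ j k, j ≠ k → cls j = cls k →
      c₀ * t ^ ((2:ℝ)/3) ≤ ‖α j t - α k t‖ ∧ ‖α j t - α k t‖ ≤ C₀ * t ^ ((2:ℝ)/3))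
    (hsep_diff : ∀ t ∈ Set.Ici T, ∀ j k, cls j ≠ cls k →
      c₀ * t ≤ ‖α j t - α k t‖) :
    ∃ T' : ℝ, T ≤ T' ∧ ∃ c > (0:ℝ), ∃ C > (0:ℝ), ∃ φ : Fin m → ℝ → E3 → ℝ,
      (∀ j x, ContDiffOn ℝ 1 (fun t => φ j t x) (Set.Ici T')) ∧
      (∀ j, ∀ t ∈ Set.Ici T', ContDiff ℝ (⊤ : ℕ∞) (φ j t)) ∧
      (∀ j, ∀ t ∈ Set.Ici T', ∀ x, 0 ≤ φ j t x ∧ φ j t x ≤ 1) ∧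
      (∀ t ∈ Set.Ici T', ∀ x, ∑ j, φ j t x = 1) ∧
      (∀ j, ∀ t ∈ Set.Ici T', ∀ x,
        |derivWithin (fun s => φ j s x) (Set.Ici T') t| + ‖fderiv ℝ (φ j t) x‖ ≤
          C * t ^ (-(2:ℝ)/3)) ∧
      (∀ j, ∀ t ∈ Set.Ici T', ∀ x,
        |derivWithin (fun s => Real.sqrt (φ j s x)) (Set.Ici T') t| +
          ‖fderiv ℝ (fun y => Real.sqrt (φ j t y)) x‖ ≤ C * t ^ (-(2:ℝ)/3)) ∧
      (∀ j, ∀ t ∈ Set.Ici T', ∀ x,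
        ‖x - α j t‖ ≤ c * t ^ ((2:ℝ)/3) → φ j t x = 1) ∧
      (∀ j k, j ≠ k → ∀ t ∈ Set.Ici T', ∀ x,
        ‖x - α k t‖ ≤ c * t ^ ((2:ℝ)/3) → φ j t x = 0) ∧
      (∀ j₀ : Fin m, ∀ t ∈ Set.Ici T', ∀ x,
        |derivWithin
            (fun s => ∑ k ∈ Finset.univ.filter (fun k => cls k = cls j₀), φ k s x)
            (Set.Ici T') t| +
          ‖fderiv ℝ
            (fun y => ∑ k ∈ Finset.univ.filter (fun k => cls k = cls j₀), φ k t y) x‖ ≤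
          C / t) := by
  have hm0 : 0 < m := by omega
  have : Nonempty (Fin m) := ⟨⟨0, hm0⟩⟩
  obtain ⟨T', hTT', hT'⟩ : ∃ T', T ≤ T' ∧
      ∀ t ∈ Set.Ici T', (c₀ / 3 + C₀) * t ^ ((2:ℝ)/3) ≤ c₀ / 3 * t ^ (1:ℝ) := by
    have h := (tendsto_rpow_atTop (show (0:ℝ) < 1/3 by norm_num)).eventually_ge_atTop
      ((c₀ / 3 + C₀) / (c₀ / 3))
    obtain ⟨A, hA⟩ := eventually_atTop.1 h
    refine ⟨max T A, le_max_left _ _, fun t ht => ?_⟩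
    have ht0 : 0 < t := by linarith [(le_max_left T A).trans ht]
    have h1 := (div_le_iff₀ (by positivity)).1 (hA t ((le_max_right T A).trans ht))
    rw [show (1:ℝ) = 1/3 + 2/3 by norm_num, rpow_add ht0, ← mul_assoc, mul_comm (c₀ / 3)]
    exact mul_le_mul_of_nonneg_right h1 (by positivity)
  have hsub : Set.Ici T' ⊆ Set.Ici T := Set.Ici_subset_Ici.2 hTT'
  have h1T' : 1 ≤ T' := hT.trans hTT'
  have hpos : ∀ t ∈ Set.Ici T', 0 < t := fun t ht => lt_of_lt_of_le one_pos (h1T'.trans ht)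
  have hα' : ∀ j, ContDiffOn ℝ 1 (α j) (Set.Ici T') := fun j => (hα j).mono hsub
  have hvel' : ∀ j, ∀ t ∈ Set.Ici T', ‖derivWithin (α j) (Set.Ici T') t‖ ≤ C₀ := fun j t ht => by
    rw [derivWithin_subset hsub (uniqueDiffOn_Ici T' t ht)
      ((hα j).differentiableOn one_ne_zero t (hsub ht))]
    exact hvel j t (hsub ht)
  -- cutoffs between classes, on the scale `t`, centred at a representative of each class
  let rep : ℕ → Fin m := Function.invFun cls
  have hrep : ∀ j, cls (rep (cls j)) = cls j := fun j => Function.invFun_eq ⟨j, rfl⟩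
  obtain ⟨a, ha, hasum, haone⟩ := exists_quadratic_partition (p := 1) (c := c₀ / 3)
    (Finset.univ.image cls) (Finset.univ_nonempty.image cls) h1T' zero_le_one le_rfl (by positivity)
    (β := fun n => α (rep n)) (fun n => hα' _) (fun n => hvel' _) (by
      intro t ht i hi k hk hik
      obtain ⟨i, -, rfl⟩ := Finset.mem_image.1 hi
      obtain ⟨k, -, rfl⟩ := Finset.mem_image.1 hk
      rw [rpow_one, mul_div_cancel₀ _ (by norm_num : (3:ℝ) ≠ 0)]
      exact hsep_diff t (hsub ht) _ _ (by rwa [hrep, hrep]))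
  -- cutoffs inside each class, on the scale `t ^ (2 / 3)`
  have hin : ∀ n ∈ Finset.univ.image cls, ∃ b : Fin m → ℝ → E3 → ℝ,
      (∀ i, IsCutoffWithRate T' (fun t => t ^ (-((2:ℝ)/3))) (b i)) ∧
      (∀ t ∈ Set.Ici T', ∀ x, ∑ i with cls i = n, b i t x ^ 2 = 1) ∧
      ∀ i ∈ Finset.univ.filter (fun i => cls i = n), ∀ t ∈ Set.Ici T', ∀ x,
        ‖x - α i t‖ ≤ c₀ / 3 * t ^ ((2:ℝ)/3) → b i t x = 1 := fun n hn => by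
    obtain ⟨j, -, hj⟩ := Finset.mem_image.1 hn
    refine exists_quadratic_partition _ ⟨j, by simpa using hj⟩ h1T' (by norm_num) (by norm_num)
      (by positivity) hα' hvel' fun t ht i hi k hk hik => ?_
    rw [mul_div_cancel₀ _ (by norm_num : (3:ℝ) ≠ 0)]
    exact (hsep_same t (hsub ht) i k hik
      ((Finset.mem_filter.1 hi).2.trans (Finset.mem_filter.1 hk).2.symm)).1
  choose! b hb hbsum hbone using hin
  have hmem : ∀ j, cls j ∈ Finset.univ.image cls := fun j =>
    Finset.mem_image_of_mem _ (Finset.mem_univ j)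
  have hroot : ∀ j, IsCutoffWithRate T' (fun t => t ^ (-((2:ℝ)/3)))
      (fun t x => a (cls j) t x * b (cls j) j t x) := fun j =>
    ((ha (cls j)).mono_rate fun t ht => ⟨(rpow_pos_of_pos (hpos t ht) _).le,
      rpow_le_rpow_of_exponent_le (h1T'.trans ht) (by norm_num)⟩).mul (hb _ (hmem j) j)
  let φ : Fin m → ℝ → E3 → ℝ := fun j t x => (a (cls j) t x * b (cls j) j t x) ^ 2
  have hφ : ∀ j, IsCutoffWithRate T' (fun t => t ^ (-((2:ℝ)/3))) (φ j) := fun j =>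
    ((hroot j).mul (hroot j)).congr fun t _ x => sq _
  have hsqrt : ∀ j, IsCutoffWithRate T' (fun t => t ^ (-((2:ℝ)/3))) (fun t x => √(φ j t x)) :=
    fun j => (hroot j).congr fun t ht x => sqrt_sq ((hroot j).mem_Icc t ht x).1
  have hclass : ∀ j₀, ∀ t ∈ Set.Ici T', ∀ x,
      ∑ k with cls k = cls j₀, φ k t x = a (cls j₀) t x ^ 2 := fun j₀ t ht x => by
    rw [Finset.sum_congr rfl fun k hk => show φ k t x =
      a (cls j₀) t x ^ 2 * b (cls j₀) k t x ^ 2 by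
        simp only [φ, (Finset.mem_filter.1 hk).2, mul_pow], ← Finset.mul_sum,
      hbsum _ (hmem j₀) t ht x, mul_one]
  have hφclass : ∀ j₀, IsCutoffWithRate T' (fun t => t ^ (-(1:ℝ)))
      (fun t x => ∑ k with cls k = cls j₀, φ k t x) := fun j₀ =>
    ((ha (cls j₀)).mul (ha (cls j₀))).congr fun t ht x => (hclass j₀ t ht x).trans (sq _)
  have hsum : ∀ t ∈ Set.Ici T', ∀ x, ∑ j, φ j t x = 1 := fun t ht x => by
    rw [← Finset.sum_fiberwise_of_maps_to (fun j _ => hmem j), ← hasum t ht x]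
    refine Finset.sum_congr rfl fun n hn => ?_
    obtain ⟨j, -, rfl⟩ := Finset.mem_image.1 hn
    exact hclass j t ht x
  have hone : ∀ j, ∀ t ∈ Set.Ici T', ∀ x,
      ‖x - α j t‖ ≤ c₀ / 3 * t ^ ((2:ℝ)/3) → φ j t x = 1 := fun j t ht x hx => by
    have hdist : ‖α j t - α (rep (cls j)) t‖ ≤ C₀ * t ^ ((2:ℝ)/3) := by
      rcases eq_or_ne j (rep (cls j)) with h | h
      · rw [← h, sub_self, norm_zero]
        exact mul_nonneg (hc₀.trans hc₀C₀).le (rpow_pos_of_pos (hpos t ht) _).le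
      · exact (hsep_same t (hsub ht) _ _ h (hrep j).symm).2
    have h1 : a (cls j) t x = 1 := by
      refine haone _ (hmem j) t ht x (le_trans ?_ (hT' t ht))
      linarith [norm_sub_le_norm_sub_add_norm_sub x (α j t) (α (rep (cls j)) t)]
    have h2 : b (cls j) j t x = 1 := hbone _ (hmem j) j (by simp) t ht x hx
    simp only [φ, h1, h2, mul_one, one_pow]
  have hr : ∀ p : ℝ, ∀ t ∈ Set.Ici T', 0 ≤ t ^ p := fun p t ht =>
    (rpow_pos_of_pos (hpos t ht) _).le
  obtain ⟨C, hC, hC1, hC2, hC3⟩ := ((eventually_gt_atTop (0:ℝ)).and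
    ((eventually_all.2 fun j => (hφ j).eventually_bound (hr _)).and
    ((eventually_all.2 fun j => (hsqrt j).eventually_bound (hr _)).and
    (eventually_all.2 fun j => (hφclass j).eventually_bound (hr _))))).exists
  refine ⟨T', hTT', c₀ / 3, by positivity, C, hC, φ, fun j => (hφ j).contDiffOn_time,
    fun j => (hφ j).contDiff_space, fun j t ht x => (hφ j).mem_Icc t ht x, hsum, ?_, ?_, hone,
    fun j k hjk t ht x hx => ?_, fun j₀ t ht x => ?_⟩
  · simpa only [neg_div] using hC1
  · simpa only [neg_div] using hC2
  · have hle := Finset.add_le_sum (f := fun i => φ i t x)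
      (fun i _ => ((hφ i).mem_Icc t ht x).1) (Finset.mem_univ j) (Finset.mem_univ k) hjk
    have h0 := ((hφ j).mem_Icc t ht x).1
    have h1 := hone k t ht x hx
    have h2 := hsum t ht x
    linarith
  · rw [div_eq_mul_inv, ← rpow_neg_one]
    exact hC3 j₀ t ht x

end
end
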